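/- arXiv:1404.0429 — 2 statements merged into one kernel-verified Lean document; each statement's English description precedes it below -/
import Mathlib

section
/- Let e = 11 and let g ∈ ℚ[y] be the degree 48 polynomial g(y) = y^48 + 2e^3·y^42 + 69e^5·y^36 + 868e^7·y^30 - 4174e^7·y^26 + 11287e^9·y^24 - 4174e^10·y^20 + 5340e^12·y^18 + 131481e^12·y^14 + 17599e^14·y^12 + 530098e^14·y^8 + 3910e^16·y^6 + 4355569e^14·y^4 + 20870e^16·y^2 + 729e^18. Then g is irreducible over ℚ, and the degree 48 number field K = ℚ[y]/(g) is ramified only at the prime 11: every prime number p dividing the discriminant of K equals 11. -/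
open Polynomial

namespace CoeffList

/-- The value at `x` of the polynomial with integer coefficients `l`, lowest degree first. -/
def eval {R : Type*} [CommRing R] (x : R) (l : List ℤ) : R :=
  l.foldr (fun (c : ℤ) (r : R) => (c : R) + x * r) 0

/-- The coefficient list of `l + c * k`, reduced modulo `m`. -/
def addMul (m c : ℤ) : List ℤ → List ℤ → List ℤ
  | [], k => k.map fun b => c * b % m
  | a :: l, [] => a :: l
  | a :: l, b :: k => (a + c * b) % m :: addMul m c l k

/-- Multiplication by the variable `X` modulo `m` and the monic polynomial `X ^ n + F`, where `F`
is given by its `n` coefficients. -/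
def mulX (m : ℤ) (F l : List ℤ) : List ℤ :=
  if l.length = F.length then addMul m (-(0 :: l).getLastD 0) (0 :: l).dropLast F else 0 :: l

/-- Multiplication modulo `m` and the monic polynomial `X ^ n + F`. -/
def mul (m : ℤ) (F k l : List ℤ) : List ℤ :=
  l.foldr (fun c r => addMul m c (mulX m F r) k) []

/-- Composition of polynomials modulo `m` and the monic polynomial `X ^ n + F`. -/
def comp (m : ℤ) (F k l : List ℤ) : List ℤ :=
  k.foldr (fun c r => addMul m c (mul m F l r) [1]) []

/-- The homogenization `∑ kᵢ lⁱ d ^ (deg k - i)` of the polynomial `k`, modulo the monic polynomial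
`X ^ n + F`. -/
def homComp (F : List ℤ) (d : ℤ) (l : List ℤ) : List ℤ → List ℤ
  | [] => []
  | c :: k => addMul 0 (c * d ^ k.length) (mul 0 F l (homComp F d l k)) [1]

/-- The coefficient list of the derivative. -/
def deriv : List ℤ → List ℤ
  | [] => []
  | _ :: l => addMul 0 1 (0 :: deriv l) l

section Eval

variable {R S : Type*} [CommRing R] [CommRing S] (x : R)

@[simp] lemma eval_nil : eval x [] = 0 := rfl

@[simp] lemma eval_cons (c : ℤ) (l : List ℤ) : eval x (c :: l) = c + x * eval x l := rfl

lemma map_eval (φ : R →+* S) (l : List ℤ) : φ (eval x l) = eval (φ x) l := by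
  induction l with
  | nil => simp
  | cons c l ih => simp [ih]

lemma eval_append (k l : List ℤ) : eval x (k ++ l) = eval x k + x ^ k.length * eval x l := by
  induction k with
  | nil => simp
  | cons c k ih => simp only [List.cons_append, eval_cons, ih, List.length_cons]; ring

lemma eval_eq_zero {l : List ℤ} (h : ∀ c ∈ l, c = 0) : eval x l = 0 := by
  induction l with
  | nil => simp
  | cons c l ih => simp [h c (by simp), ih fun b hb => h b (by simp [hb])]

lemma eval_replicate_zero (n : ℕ) : eval x (List.replicate n 0) = 0 :=
  eval_eq_zero x fun _ h => List.eq_of_mem_replicate h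

lemma eval_dropLast (a : ℤ) (l : List ℤ) :
    eval x (a :: l).dropLast + x ^ l.length * ((a :: l).getLastD 0 : ℤ) = eval x (a :: l) := by
  conv_rhs => rw [← List.dropLast_append_getLast (List.cons_ne_nil a l), eval_append]
  simp [List.getLastD_eq_getLast?, List.getLast?_eq_getLast_of_ne_nil]

variable {x}

lemma cast_emod {m : ℤ} (hm : (m : R) = 0) (a : ℤ) : ((a % m : ℤ) : R) = a := by
  simp [Int.emod_def, hm]

lemma eval_addMul {m : ℤ} (hm : (m : R) = 0) (c : ℤ) (l k : List ℤ) :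
    eval x (addMul m c l k) = eval x l + c * eval x k := by
  fun_induction addMul m c l k with
  | case1 k =>
    induction k with
    | nil => simp
    | cons b k ih =>
      simp only [List.map_cons, eval_cons, ih, cast_emod hm, eval_nil]
      push_cast
      ring
  | case2 a l => simp
  | case3 a l b k ih =>
    simp only [eval_cons, ih, cast_emod hm]
    push_cast
    ring

lemma eval_addMul_zero (c : ℤ) (l k : List ℤ) :
    eval x (addMul 0 c l k) = eval x l + c * eval x k :=
  eval_addMul Int.cast_zero c l k

lemma eval_mulX {m : ℤ} (hm : (m : R) = 0) {F : List ℤ} (hF : eval x F + x ^ F.length = 0)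
    (l : List ℤ) : eval x (mulX m F l) = x * eval x l := by
  unfold mulX
  split_ifs with h
  · have h' := eval_dropLast x 0 l
    rw [h, eval_cons] at h'
    rw [eval_addMul hm]
    push_cast at h' ⊢
    linear_combination h' - ((0 :: l).getLastD 0 : ℤ) * hF
  · simp

lemma eval_mul {m : ℤ} (hm : (m : R) = 0) {F : List ℤ} (hF : eval x F + x ^ F.length = 0)
    (k l : List ℤ) : eval x (mul m F k l) = eval x k * eval x l := by
  induction l with
  | nil => simp [mul]
  | cons c l ih =>
    have : mul m F k (c :: l) = addMul m c (mulX m F (mul m F k l)) k := rfl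
    rw [this, eval_addMul hm, eval_mulX hm hF, ih, eval_cons]
    ring

lemma eval_comp {m : ℤ} (hm : (m : R) = 0) {F : List ℤ} (hF : eval x F + x ^ F.length = 0)
    (k l : List ℤ) : eval x (comp m F k l) = eval (eval x l) k := by
  induction k with
  | nil => simp [comp]
  | cons c k ih =>
    have : comp m F (c :: k) l = addMul m c (mul m F l (comp m F k l)) [1] := rfl
    rw [this, eval_addMul hm, eval_mul hm hF, ih, eval_cons]
    simp [add_comm]

lemma eval_homComp {F : List ℤ} (hF : eval x F + x ^ F.length = 0) {d : ℤ} {l : List ℤ} {y : R}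
    (hl : eval x l = d * y) (k : List ℤ) :
    d * eval x (homComp F d l k) = d ^ k.length * eval y k := by
  induction k with
  | nil => simp [homComp]
  | cons c k ih =>
    rw [homComp, eval_addMul_zero, eval_mul Int.cast_zero hF, hl, eval_cons, List.length_cons]
    simp only [eval_cons, eval_nil]
    push_cast
    linear_combination (d : R) * y * ih

lemma derivative_eval (l : List ℤ) : derivative (eval X l : ℤ[X]) = eval X (deriv l) := by
  induction l with
  | nil => simp [deriv]
  | cons c l ih => simp [deriv, eval_addMul_zero, ih, add_comm]

lemma aeval_eval [Algebra ℤ R] (l : List ℤ) : aeval x (eval X l : ℤ[X]) = eval x l := by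
  rw [← AlgHom.coe_toRingHom, map_eval]; simp

end Eval

end CoeffList

/-- **Rabin's irreducibility test** over a finite field. -/
lemma irreducible_of_dvd_X_pow_card_pow_sub_X {k : Type*} [Field k] [Finite k] {P : k[X]}
    (hpos : P.natDegree ≠ 0) (hdvd : P ∣ X ^ Nat.card k ^ P.natDegree - X)
    (hcop : ∀ r, r.Prime → r ∣ P.natDegree →
      IsCoprime P (X ^ Nat.card k ^ (P.natDegree / r) - X)) : Irreducible P := by
  obtain ⟨q, hq, hqP⟩ := WfDvdMonoid.exists_irreducible_factor
    (fun h => hpos (natDegree_eq_zero_of_isUnit h)) (fun h => hpos (by simp [h]))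
  obtain ⟨d, hd⟩ := hq.natDegree_dvd_of_dvd_X_pow_card_pow_sub_X (hqP.trans hdvd)
  have hd1 : d = 1 := by
    by_contra hne
    obtain ⟨r, hr, t, rfl⟩ := Nat.exists_prime_and_dvd hne
    have hdiv : P.natDegree / r = q.natDegree * t := by
      rw [hd, mul_left_comm, Nat.mul_div_cancel_left _ hr.pos]
    refine hq.not_isUnit ((hcop r hr ⟨q.natDegree * t, by rw [hd]; ring⟩).isUnit_of_dvd' hqP ?_)
    rw [← hq.natDegree_dvd_iff_dvd_X_pow_card_pow_sub_X, hdiv]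
    exact dvd_mul_right _ _
  rw [hd1, mul_one] at hd
  have hP0 : P ≠ 0 := fun h => hpos (by simp [h])
  exact (associated_of_dvd_of_natDegree_le hqP hP0 hd.le).irreducible hq

namespace CoeffList

variable {R : Type*} [CommRing R] {x : R}

lemma eval_comp_pow_char {p : ℕ} [Fact p.Prime] [CharP R p] {F : List ℤ}
    (hF : eval x F + x ^ F.length = 0) {k l : List ℤ} {a b : ℕ}
    (hk : eval x k = x ^ p ^ a) (hl : eval x l = x ^ p ^ b) :
    eval x (comp p F k l) = x ^ p ^ (a + b) := by
  have h := map_eval x (iterateFrobenius R p b) k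
  rw [hk, iterateFrobenius_def, iterateFrobenius_def] at h
  rw [eval_comp (by simp) hF, hl, ← h, ← pow_mul, pow_add]

lemma eval_iterate_mulX {m : ℤ} (hm : (m : R) = 0) {F : List ℤ}
    (hF : eval x F + x ^ F.length = 0) (n : ℕ) : eval x ((mulX m F)^[n] [1]) = x ^ n := by
  induction n with
  | zero => simp
  | succ n ih => rw [Function.iterate_succ_apply', eval_mulX hm hF, ih, pow_succ']

lemma degree_eval_X_lt (k : Type*) [CommRing k] [Nontrivial k] (F : List ℤ) :
    degree (eval X F : k[X]) < F.length := by
  induction F with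
  | nil => simp
  | cons c F ih =>
    rw [eval_cons, List.length_cons]
    refine (degree_add_le _ _).trans_lt (max_lt ?_ ?_)
    · rw [← map_intCast (C : k →+* k[X])]
      exact degree_C_le.trans_lt (by exact_mod_cast Nat.succ_pos _)
    · rw [mul_comm, degree_mul_X]
      by_cases h : (eval X F : k[X]) = 0
      · rw [h]; simp
      · rw [degree_eq_natDegree h] at ih ⊢
        exact_mod_cast Nat.succ_lt_succ (by exact_mod_cast ih)

lemma monic_eval_X_add (k : Type*) [CommRing k] [Nontrivial k] (F : List ℤ) :
    (eval X F + X ^ F.length : k[X]).Monic := by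
  rw [add_comm]; exact monic_X_pow_add (degree_eval_X_lt k F)

lemma natDegree_eval_X_add (k : Type*) [CommRing k] [Nontrivial k] (F : List ℤ) :
    (eval X F + X ^ F.length : k[X]).natDegree = F.length := by
  rw [natDegree_add_eq_right_of_degree_lt, natDegree_X_pow]
  rw [degree_X_pow]; exact degree_eval_X_lt k F

lemma eval_root (k : Type*) [CommRing k] (F : List ℤ) :
    let x := AdjoinRoot.root (eval X F + X ^ F.length : k[X])
    eval x F + x ^ F.length = 0 := by
  intro x
  have h := AdjoinRoot.mk_self (f := (eval X F + X ^ F.length : k[X]))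
  rwa [map_add, map_eval, map_pow, AdjoinRoot.mk_X] at h

/-- Rabin's test in degree `24`, where `Aᵢ` is the coefficient list of `X ^ p ^ i` modulo the
polynomial to be tested. -/
lemma irreducible_of_frobenius_powers {p : ℕ} [Fact p.Prime]
    {F A₁ A₂ A₄ A₈ A₁₂ u₈ u₁₂ : List ℤ} (hlen : F.length = 24)
    (h₁ : (mulX p F)^[p] [1] = A₁) (h₂ : comp p F A₁ A₁ = A₂) (h₄ : comp p F A₂ A₂ = A₄)
    (h₈ : comp p F A₄ A₄ = A₈) (h₁₂ : comp p F A₈ A₄ = A₁₂)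
    (h₂₄ : comp p F A₁₂ A₁₂ = [0, 1] ++ List.replicate 22 0)
    (hu₈ : mul p F u₈ (addMul p (-1) A₈ [0, 1]) = [1] ++ List.replicate 23 0)
    (hu₁₂ : mul p F u₁₂ (addMul p (-1) A₁₂ [0, 1]) = [1] ++ List.replicate 23 0) :
    Irreducible (eval X F + X ^ F.length : (ZMod p)[X]) := by
  set P : (ZMod p)[X] := eval X F + X ^ F.length with hP
  have hdeg : P.natDegree = 24 := by rw [hP, natDegree_eval_X_add, hlen]
  have hp : ((p : ℤ) : AdjoinRoot P) = 0 := by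
    rw [Int.cast_natCast, ← map_natCast (AdjoinRoot.of P), CharP.cast_eq_zero, map_zero]
  have : Nontrivial (AdjoinRoot P) :=
    AdjoinRoot.nontrivial P (fun h => by simp [natDegree_eq_of_degree_eq_some h] at hdeg)
  have : CharP (AdjoinRoot P) p :=
    charP_of_injective_ringHom (AdjoinRoot.of P).injective p
  have hF := eval_root (ZMod p) F
  rw [← hP] at hF
  set x := AdjoinRoot.root P
  have e₁ : eval x A₁ = x ^ p ^ 1 := by rw [← h₁, eval_iterate_mulX hp hF, pow_one]
  have e₂ : eval x A₂ = x ^ p ^ 2 := by rw [← h₂, eval_comp_pow_char hF e₁ e₁]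
  have e₄ : eval x A₄ = x ^ p ^ 4 := by rw [← h₄, eval_comp_pow_char hF e₂ e₂]
  have e₈ : eval x A₈ = x ^ p ^ 8 := by rw [← h₈, eval_comp_pow_char hF e₄ e₄]
  have e₁₂ : eval x A₁₂ = x ^ p ^ 12 := by rw [← h₁₂, eval_comp_pow_char hF e₈ e₄]
  have e₂₄ : x = x ^ p ^ 24 := by
    have h := eval_comp_pow_char hF e₁₂ e₁₂
    rw [h₂₄, eval_append, eval_replicate_zero] at h
    simpa using h
  have key {A u : List ℤ} {n : ℕ} (hA : eval x A = x ^ p ^ n)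
      (hu : mul p F u (addMul p (-1) A [0, 1]) = [1] ++ List.replicate 23 0) :
      IsCoprime P (X ^ p ^ n - X) := by
    have h := eval_mul hp hF u (addMul p (-1) A [0, 1])
    rw [hu, eval_append, eval_replicate_zero, eval_addMul hp, hA] at h
    have h' : AdjoinRoot.mk P (1 - eval X u * (X ^ p ^ n - X)) = 0 := by
      simp only [map_sub, map_mul, map_one, map_eval, map_pow, AdjoinRoot.mk_X]
      simp only [eval_cons, eval_nil] at h
      push_cast at h
      linear_combination h
    obtain ⟨c, hc⟩ := AdjoinRoot.mk_eq_zero.mp h'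
    exact ⟨c, eval X u, by linear_combination -hc⟩
  apply irreducible_of_dvd_X_pow_card_pow_sub_X (by simp [hdeg])
  · rw [hdeg, Nat.card_zmod, ← AdjoinRoot.mk_eq_zero, map_sub, map_pow, AdjoinRoot.mk_X,
      sub_eq_zero]
    exact e₂₄.symm
  · intro r hr hrd
    rw [hdeg] at hrd ⊢
    rw [Nat.card_zmod]
    have : r = 2 ∨ r = 3 := by
      rw [show 24 = 2 ^ 3 * 3 by norm_num, hr.dvd_mul] at hrd
      refine hrd.imp (fun h => ?_) fun h => ?_
      · exact (Nat.prime_dvd_prime_iff_eq hr Nat.prime_two).mp (hr.dvd_of_dvd_pow h)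
      · exact (Nat.prime_dvd_prime_iff_eq hr Nat.prime_three).mp h
    obtain rfl | rfl := this
    · exact key e₁₂ hu₁₂
    · exact key e₈ hu₈

end CoeffList

namespace CoeffList

/-- The coefficients below the leading one of the monic polynomial `f` of degree `24` such that the
polynomial of degree `48` under study is `f (y ^ 2)`. -/
def quotCoeffs : List ℤ :=
  [4053179721535836749649, 958970862252751000070, 1654026602910323419129, 179663443766567149510,
   201304627282808887618, 0, 6683217321231458359, 412643701399653801, 0, 16759207531690140,
   -108262810284574, 0, 26614155588317, -81339451754, 0, 16914864428, 0, 0, 11112519, 0, 0, 2662,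
   0, 0]

/-- The lower coefficients of one of the two irreducible factors of `f (y ^ 2)` modulo `139`. -/
def modFactor₁ : List ℤ :=
  [111, 0, 107, 0, 55, 0, 120, 0, 39, 0, 68, 0, 21, 0, 60, 0, 88, 0, 30, 0, 47, 0, 51, 0]

/-- The lower coefficients of the other irreducible factor of `f (y ^ 2)` modulo `139`. -/
def modFactor₂ : List ℤ :=
  [115, 0, 36, 0, 44, 0, 104, 0, 30, 0, 132, 0, 39, 0, 71, 0, 91, 0, 14, 0, 52, 0, 88, 0]

set_option maxRecDepth 100000 in
lemma irreducible_modFactor₁ :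
    Irreducible (eval X modFactor₁ + X ^ modFactor₁.length : (ZMod 139)[X]) := by
  have : Fact (Nat.Prime 139) := ⟨by norm_num⟩
  refine irreducible_of_frobenius_powers rfl
    (A₁ :=
    [0, 130, 0, 99, 0, 96, 0, 41, 0, 49, 0, 59, 0, 70, 0, 122, 0, 77, 0, 51, 0, 82, 0, 102])
    (A₂ :=
    [0, 40, 0, 2, 0, 54, 0, 47, 0, 6, 0, 25, 0, 6, 0, 99, 0, 131, 0, 66, 0, 46, 0, 83])
    (A₄ :=
    [0, 40, 0, 102, 0, 135, 0, 96, 0, 21, 0, 119, 0, 110, 0, 131, 0, 9, 0, 138, 0, 9, 0, 62])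
    (A₈ :=
    [0, 120, 0, 90, 0, 0, 0, 5, 0, 100, 0, 136, 0, 118, 0, 44, 0, 56, 0, 10, 0, 57, 0, 2])
    (A₁₂ :=
    [0, 138, 0, 0, 0, 0, 0, 0, 0, 0, 0, 0, 0, 0, 0, 0, 0, 0, 0, 0, 0, 0, 0, 0])
    (u₈ :=
    [0, 17, 0, 31, 0, 36, 0, 16, 0, 63, 0, 78, 0, 8, 0, 56, 0, 31, 0, 131, 0, 21, 0, 26])
    (u₁₂ :=
    [0, 80, 0, 71, 0, 117, 0, 111, 0, 108, 0, 17, 0, 128, 0, 58, 0, 64, 0, 91, 0, 81, 0, 67])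
    ?_ ?_ ?_ ?_ ?_ ?_ ?_ ?_ <;> decide +kernel

set_option maxRecDepth 100000 in
lemma irreducible_modFactor₂ :
    Irreducible (eval X modFactor₂ + X ^ modFactor₂.length : (ZMod 139)[X]) := by
  have : Fact (Nat.Prime 139) := ⟨by norm_num⟩
  refine irreducible_of_frobenius_powers rfl
    (A₁ :=
    [0, 78, 0, 32, 0, 43, 0, 50, 0, 87, 0, 82, 0, 120, 0, 124, 0, 29, 0, 107, 0, 16, 0, 64])
    (A₂ :=
    [0, 68, 0, 106, 0, 138, 0, 108, 0, 120, 0, 75, 0, 37, 0, 137, 0, 103, 0, 31, 0, 80, 0, 36])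
    (A₄ :=
    [0, 29, 0, 76, 0, 65, 0, 50, 0, 79, 0, 28, 0, 36, 0, 125, 0, 7, 0, 109, 0, 85, 0, 100])
    (A₈ :=
    [0, 83, 0, 50, 0, 20, 0, 62, 0, 29, 0, 112, 0, 46, 0, 35, 0, 42, 0, 55, 0, 108, 0, 66])
    (A₁₂ :=
    [0, 138, 0, 0, 0, 0, 0, 0, 0, 0, 0, 0, 0, 0, 0, 0, 0, 0, 0, 0, 0, 0, 0, 0])
    (u₈ :=
    [0, 81, 0, 9, 0, 4, 0, 96, 0, 21, 0, 78, 0, 48, 0, 109, 0, 95, 0, 82, 0, 93, 0, 1])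
    (u₁₂ :=
    [0, 34, 0, 57, 0, 21, 0, 121, 0, 32, 0, 60, 0, 13, 0, 1, 0, 75, 0, 80, 0, 114, 0, 55])
    ?_ ?_ ?_ ?_ ?_ ?_ ?_ ?_ <;> decide +kernel

lemma modFactor_dvd {F : List ℤ} (h : ∀ c ∈ comp 139 F (quotCoeffs ++ [1]) [0, 0, 1], c = 0) :
    (eval X F + X ^ F.length : (ZMod 139)[X]) ∣ eval (X ^ 2) (quotCoeffs ++ [1]) := by
  have h139 := eval_comp
    (show ((139 : ℤ) : AdjoinRoot (eval X F + X ^ F.length : (ZMod 139)[X])) = 0 by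
      rw [← map_intCast (AdjoinRoot.of (eval X F + X ^ F.length : (ZMod 139)[X])), show ((139 : ℤ) : ZMod 139) = 0 from rfl, map_zero])
    (eval_root (ZMod 139) F) (quotCoeffs ++ [1]) [0, 0, 1]
  rw [eval_eq_zero _ h] at h139
  rw [← AdjoinRoot.mk_eq_zero, map_eval, map_pow, AdjoinRoot.mk_X, h139]
  simp [pow_two]

set_option maxRecDepth 100000 in
lemma modFactor₁_dvd : (eval X modFactor₁ + X ^ modFactor₁.length : (ZMod 139)[X]) ∣
    eval (X ^ 2) (quotCoeffs ++ [1]) :=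
  modFactor_dvd (by decide +kernel)

set_option maxRecDepth 100000 in
lemma modFactor₂_dvd : (eval X modFactor₂ + X ^ modFactor₂.length : (ZMod 139)[X]) ∣
    eval (X ^ 2) (quotCoeffs ++ [1]) :=
  modFactor_dvd (by decide +kernel)

lemma eval_X_pow_two (k : Type*) [CommRing k] (l : List ℤ) :
    (eval (X ^ 2) l : k[X]) = (eval X l : k[X]).comp (X ^ 2) := by
  rw [← coe_compRingHom_apply, map_eval, coe_compRingHom_apply, X_comp]

end CoeffList

/-- A monic integral polynomial which is a product of two monic irreducible polynomials modulo `p`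
is irreducible if no divisor of its constant coefficient is congruent to the constant coefficient
of the first factor. -/
lemma irreducible_of_map_eq_mul {p : ℕ} [Fact p.Prime] {P : ℤ[X]} (hP : P.Monic)
    {h₁ h₂ : (ZMod p)[X]} (hm : h₁.Monic) (hi₁ : Irreducible h₁) (hi₂ : Irreducible h₂)
    (hmap : P.map (Int.castRingHom (ZMod p)) = h₁ * h₂)
    (hcoeff : ∀ a : ℤ, a ∣ P.coeff 0 → (a : ZMod p) ≠ h₁.coeff 0) : Irreducible P := by
  have key {a b : ℤ[X]} (ha : a.Monic) (hb : b.Monic) (hab : a * b = P)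
      (h : h₁ ∣ a.map (Int.castRingHom (ZMod p))) : b = 1 := by
    obtain ⟨c, hc⟩ := h
    have hcb : c * b.map (Int.castRingHom (ZMod p)) = h₂ := by
      apply mul_left_cancel₀ hm.ne_zero
      rw [← hmap, ← hab, Polynomial.map_mul, hc, mul_assoc]
    obtain hu | hu := hi₂.isUnit_or_isUnit hcb.symm
    · have hc1 : c = 1 := by
        refine Monic.eq_one_of_isUnit (hm.of_mul_monic_left ?_) hu
        rw [← hc]
        exact ha.map _
      refine absurd ?_ (hcoeff (a.coeff 0) ⟨b.coeff 0, by rw [← mul_coeff_zero, hab]⟩)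
      rw [← mul_one h₁, ← hc1, ← hc, coeff_map, eq_intCast]
    · rw [← hb.natDegree_eq_zero, ← hb.natDegree_map (Int.castRingHom (ZMod p))]
      exact natDegree_eq_zero_of_isUnit hu
  rw [irreducible_of_monic hP]
  · intro a b ha hb hab
    have hdvd : h₁ ∣ a.map (Int.castRingHom (ZMod p)) * b.map (Int.castRingHom (ZMod p)) := by
      rw [← Polynomial.map_mul, hab, hmap]
      exact dvd_mul_right _ _
    obtain h | h := hi₁.prime.dvd_or_dvd hdvd
    · exact Or.inr (key ha hb hab h)
    · exact Or.inl (key hb ha (by rw [mul_comm, hab]) h)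
  · rintro rfl
    rw [Polynomial.map_one] at hmap
    exact hi₁.not_isUnit (IsUnit.of_mul_eq_one _ hmap.symm)

lemma intCast_zmod_ne_of_dvd {a : ℤ} (ha : a ∣ 3 ^ 6 * 11 ^ 18) : (a : ZMod 139) ≠ 111 := by
  have h : a.natAbs ∣ 3 ^ 6 * 11 ^ 18 := by
    simpa [Int.natAbs_mul, Int.natAbs_pow] using Int.natAbs_dvd_natAbs.mpr ha
  obtain ⟨b, c, hb, hc, hbc⟩ := (Nat.dvd_mul).mp h
  obtain ⟨i, hi, rfl⟩ := (Nat.dvd_prime_pow Nat.prime_three).mp hb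
  obtain ⟨j, hj, rfl⟩ := (Nat.dvd_prime_pow (by norm_num)).mp hc
  have key : ∀ i ≤ 6, ∀ j ≤ 18,
      (3 ^ i * 11 ^ j : ZMod 139) ≠ 111 ∧ -(3 ^ i * 11 ^ j : ZMod 139) ≠ 111 := by
    decide +kernel
  obtain h | h := a.natAbs_eq <;> rw [h, ← hbc] <;> push_cast
  · exact (key i hi j hj).1
  · exact (key i hi j hj).2

namespace CoeffList

lemma coeff_zero_eval_X (k : Type*) [CommRing k] (c : ℤ) (l : List ℤ) :
    (eval X (c :: l) : k[X]).coeff 0 = c := by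
  simp [coeff_zero_eq_eval_zero]

lemma monic_eval_quotCoeffs (k : Type*) [CommRing k] [Nontrivial k] :
    (eval X (quotCoeffs ++ [1]) : k[X]).Monic := by
  have h := monic_eval_X_add k quotCoeffs
  rwa [eval_append, eval_cons, eval_nil, Int.cast_one, mul_zero, add_zero, mul_one]

lemma natDegree_eval_quotCoeffs (k : Type*) [CommRing k] [Nontrivial k] :
    (eval X (quotCoeffs ++ [1]) : k[X]).natDegree = 24 := by
  have h := natDegree_eval_X_add k quotCoeffs
  rwa [eval_append, eval_cons, eval_nil, Int.cast_one, mul_zero, add_zero, mul_one]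

lemma monic_eval_sq (k : Type*) [CommRing k] [Nontrivial k] :
    (eval (X ^ 2) (quotCoeffs ++ [1]) : k[X]).Monic := by
  rw [eval_X_pow_two, ← expand_eq_comp_X_pow]
  exact (monic_eval_quotCoeffs k).expand two_pos

theorem irreducible_eval_sq : Irreducible (eval (X ^ 2) (quotCoeffs ++ [1]) : ℤ[X]) := by
  have hne : (111 : ZMod 139) ≠ 115 := by decide
  have : Fact (Nat.Prime 139) := ⟨by norm_num⟩
  have hmon₁ := monic_eval_X_add (ZMod 139) modFactor₁
  have hmon₂ := monic_eval_X_add (ZMod 139) modFactor₂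
  have hc₁ : (eval X modFactor₁ + X ^ modFactor₁.length : (ZMod 139)[X]).coeff 0 = 111 := by
    rw [coeff_add, modFactor₁, coeff_zero_eval_X]
    simp
  have hc₂ : (eval X modFactor₂ + X ^ modFactor₂.length : (ZMod 139)[X]).coeff 0 = 115 := by
    rw [coeff_add, modFactor₂, coeff_zero_eval_X]
    simp
  have hcop : IsCoprime (eval X modFactor₁ + X ^ modFactor₁.length : (ZMod 139)[X])
      (eval X modFactor₂ + X ^ modFactor₂.length) := by
    refine irreducible_modFactor₁.coprime_iff_not_dvd.mpr fun h => ?_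
    have h' := eq_of_monic_of_dvd_of_natDegree_le hmon₁ hmon₂ h
      (by rw [natDegree_eval_X_add, natDegree_eval_X_add]; rfl)
    rw [h', hc₁] at hc₂
    exact hne hc₂
  refine irreducible_of_map_eq_mul (monic_eval_sq ℤ) hmon₁ irreducible_modFactor₁
    irreducible_modFactor₂ ?_ fun a ha => ?_
  · rw [← coe_mapRingHom, map_eval, map_pow, coe_mapRingHom, map_X]
    refine (eq_of_monic_of_dvd_of_natDegree_le (hmon₁.mul hmon₂) (monic_eval_sq _)
      (hcop.mul_dvd modFactor₁_dvd modFactor₂_dvd) ?_)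
    rw [hmon₁.natDegree_mul hmon₂, natDegree_eval_X_add, natDegree_eval_X_add, eval_X_pow_two,
      ← expand_eq_comp_X_pow, natDegree_expand, natDegree_eval_quotCoeffs]
    rfl
  · rw [hc₁]
    refine intCast_zmod_ne_of_dvd ?_
    rw [eval_X_pow_two, ← expand_eq_comp_X_pow, coeff_expand two_pos, if_pos (dvd_zero 2),
      Nat.zero_div, quotCoeffs, List.cons_append, coeff_zero_eval_X] at ha
    simpa using ha

end CoeffList

namespace CoeffList

/-- The lower coefficients of the minimal polynomial of a second integral generator of the number
field defined by `f`. -/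
def altCoeffs : List ℤ :=
  [2164569, -25558709, 91442967, -110558184, 126291935, -52794115, 44444752, -3632299, 6400779,
   3572404, 1888689, 670505, 719323, 12375, 76956, 29645, 3630, -2541, 3025, -726, 0, 0, 16, -8]

/-- The numerator of the second generator, as a polynomial in a root of `f`. -/
def altNum : List ℤ :=
  [-725251339369222604654735402309799862718364189240308579484967,
   -203688450485261697509658772421479407033199034009445679401477,
   -233928696373841540461593024952878198518106885683757778829564,
   -12811619143969376342116987786660151777157928545584363113112,
   -7511615261510199578547017041713310124560652636380615986451,
   -990626381724647388091277076854223118690638777816987249290,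
   -30586748908100237130883546895362581378651565538800048095,
   -18398698807177306168081009882727747957121248429187110274,
   -1113381126680905812635164932567101580262354197132079581,
   1303494372789893320286994546016453518539381035331307,
   -30050264727706860709862583932332163156271915577095525,
   -1869040433076118733497224584274518128475084108264873,
   1974286270316084006500261322408303349936923965132,
   -19044370298416660481088362221775848409188745142375,
   -1238614525832123647064608137976949595449491878799,
   -3646666539029293758964353990541631811403003029,
   -12684039344201343220919058873642674760029274705,
   -816630348736758960116548265305721627921829723, -781527218702649796914230149062864776990658,
   -3021231202761613591081240264763294667559659, -194783948405625276288669713937287027117823,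
   -374448077298475746750124636353271748343, -1149497217368499833857763139689167812015,
   -73480712660463343466649209791773555221]

/-- The denominator of the second generator. -/
def altDen : ℤ := 130493954327093605011687812456226198686870234307815269974635

/-- The numerator of a root of `f`, as a polynomial in the second generator. -/
def backNum : List ℤ :=
  [-2826535576432524107864561197679886787143429076538050498003459680083890,
   18397168016743773856579956387631371076884021276766688874447246393886139,
   -21854665861474159329968462876501037273989994159953342784185830929304792,
   29081475022620915534985137598774368673539973933531163425820087586932147,
   -11018332983742978408346300195810974950619712746424932711036893459925063,
   10851786428567488329915243731696257719315566030108376602980549891450111,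
   -577108212661218579127050457018928496790660506272434734270214382791749,
   1757514843217865817001790004852986205443899894635334453103807695692473,
   974340549690665118457773668525536159683217465509971186640300387568305,
   502471198797202198029802403594050177136520238509994472862645453678476,
   198595753297438633804002894383053669035273337060401217715187759411199,
   178755819846021859950511969548185036880050066643476225254077834755982,
   6840813493850692517760061660448985270085556028705621715126059170724,
   20377844002697286242012872955228728286144966260002231647972974896284,
   7467322776712993278404454329239872305922946760007350885615480366833,
   803340439126758667582749022282416121483705919208364163847563014491,
   -493666045695638282203282766094182522494268703649112564458208242524,
   713173483904990336131537305938940091289757853991283246994461057780,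
   -179175493750442884352373205043843581496964223764214762825995553640,
   124774673555976344034741017118742421390398398218881184752978323,
   673504130930731931888372354218640250621654877875623286316645931,
   3588724303396771942937299118319047152096495734045478117205170067,
   -1928646377574797157670421355026142564894365598830358600565244397,
   246841852284221755185182733566447787851741469203560495089786636]

/-- The denominator of a root of `f`, as a polynomial in the second generator. -/
def backDen : ℤ :=
  9441072145893141269098778672763282259227771104269455033287700592784

/-- Coefficients of a multiplier of the derivative of `f` giving an integer modulo `f`. -/
def quotCofactor : List ℤ :=
  [-3286771607330535393691493519899460064053604057230845248176930586461948717348592014204389681854616340,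
   11497118716619337517152635935864683169964940634582641546601106186967889754897997672305142408726167683,
   639470888590966356178157210430081004970342984341214177387884301454357644780844587383002798208229935,
   3075846423453480099831219467700686022248525083724534563336146879458027979360901828738719737584830151,
   -147314562045335463435843035792640752744760587505961848903329035256367662439232650717835549739918461,
   113929202185746139793201916829605801322246555891411973222947165548237574413381314711039447180418809,
   5922016993316055104868498859473130089249586393377322185917634655385480436187957847555034176942817,
   -276493185359397885773975517553014552170508167306719609816869923256559140681145947604256371024162,
   304180950155959806601909119694296910796170164434501500057235883594500302992713758312147342246093,
   -4211302030859189007899766073997458160492887293035313444067771987341856665538135489988783400148,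
   -456940557874849190915108979616435912112398840278010514916981969941926560441714511439702708281,
   478343831101835205832237325421625022981895121658205147267480536429964275443101112684787187154,
   -2893560121662817048332999335418248475630332610184113356183745507552900937308988773742826003,
   -294509035735214466462277908474444688889299984965131008653137202254256012951872747641098392,
   303162698439797223289641435372169968048984168103232406475317293345631992844746552985883751,
   -948475037662961045885396313326602927171972047216977499876607670977030952082316985905152,
   -195414699070836037503826125144568801218766009694006681384698701543347281012766561497195,
   198585222201643068641094460412596418304833685758177810919439774242435356632557659125962,
   -227142105115357222486787466222393035133941223182748629745428514905108983800963353127,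
   -46649368626875300403269128194621821534901051919625250771749171734916504206770741508,
   47617583794252715375729746477554635055808887685239506252908617051110569475510850337,
   -85397956737742604085615337097758291038581619981588983232347802104905286116127052,
   -17682785437381306409749095529591811597207787219636653281493333771946785082663661,
   17840545468411123878053796751713849910766009577509473834622124984068864423171140]

/-- An integer in the ideal generated by the derivative of `f` modulo `f`. -/
def quotInt : ℤ :=
  22665162586291638684693864679074772116894871519899860391130011602057808054176822237133022370709237373579521131566243072475

/-- Coefficients of a multiplier of the derivative of the minimal polynomial of the second generator
giving an integer modulo that polynomial. -/
def altCofactor : List ℤ :=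
  [12885534503923342569512958356525369585199635500114833631367281888744119772248217455736750332438047779774736157113028416544485537477621,
   -83216547952488644590566900951628478858987535008099758105874436713030049804673822369844358188703452829527398633376404112701188127420535,
   98387622380318312651005116146215455247707730495048502435115405312231318633339003735517888752212222065722070407807657172139507307820340,
   -131018010707763005146133093288676175639407358632964614194923940136257696789492807082154413406584620798624011663918518910397305355337136,
   49532464550754292002665428838770782977946471905371157259923833609507234642935190103189887032525169973808413264878140502289200804152135,
   -48876348855470546578877047027512307640137098842349193734358118392809138528538287692099748420289616495098694241748081565128880417209209,
   2560449600525754288595065779966087538636109828909080345503163366740021227486441402184732893088881695283195939416939015444464856353207,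
   -7923681357053956880373683067456524452507323033797187389138207031844122789797065558756392442273555179949207563266458558571148506674705,
   -4387901846297619310642996264598234743845658323210169849116533715277180230313077604933577705767086412977902292883602304656387796311346,
   -2263516764745290361769021331680575150716659962463058330977069712256435369146753417394119830286214797303051300812729506612099989283128,
   -894234703292983767039145111793472113103979538316578733159387335032549701342452868823530782162682161013861662423371098406441676395805,
   -804491635823226769391068801392677507372161308274666346674651897369385660337293553741923064469148673380001700845269665710964056672139,
   -30795313420377891820309130350841298366313996269037315847801374774260348327850235875907540204708921797262571730851992001181827385460,
   -91706535610215936968973733023116904566882359356298541628742308814345730207363293168361247409383554434110559388026494544902712018345,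
   -33592917520010218434369867020658015144772906906725932615603571494001808445707171980226754810379187701383734663727850273673784321478,
   -3616454493131597771314098487744238794135382497377173765030682795971892023130529768102225160190512242410721584023763829954776255838,
   2224459668188825649747433916919182698481994058479417714639982991498431063297523815169994105061317306401345692989464224628166263831,
   -3209202657415497510224708614857608021858570594470132793544337289998169081295199086048082640040699415079223061294051691231781663582,
   806100355861630487199903892533545210664781054030954915562429762622733243436718670645624712835320378567666506067899023536403629609,
   -556339127560406734336430183375391737589459039619103707032460605545318282478836552508762795543594773976390998164183542846670686,
   -3007135508375798200353870365926040465963125715451686149316612507882049778030040532332278611154141287100503457009321571139386719,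
   -16152929893259670182791431362328816572380853887311122088911382918048508753369444459805710494249634054536891996853859060962248073,
   8677165563667841832140132227208947822182340575425424120168424897878241584196373609276503444786616375624478649489747477662498832,
   -1110470078852891197003723451197499929392131995061402648126003701794055563709660469085882919025465457750356427179386412393666825]

/-- An integer in the ideal generated by the derivative of the minimal polynomial of the second
generator modulo that polynomial. -/
def altInt : ℤ :=
  474548581537319437463621749392552338518445497226406925393565718366908924032349591326062701050866525043014322119959657501286978822043372544

/-- A square root of `X` modulo `4` and `f`. -/
def sqrtCoeffs : List ℤ :=
  [0, 1, 0, 0, 0, 0, 0, 0, 0, 0, 1, 1, 0, 0, 0, 1, 1, 1, 0, 0, 0, 1, 1, 1]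

set_option maxRecDepth 100000 in
lemma homComp_altNum : ∀ c ∈ homComp quotCoeffs altDen altNum (altCoeffs ++ [1]), c = 0 := by
  decide +kernel

set_option maxRecDepth 100000 in
lemma homComp_backNum : homComp quotCoeffs altDen altNum backNum =
    [0, backDen * altDen ^ 23] ++ List.replicate 22 0 := by
  decide +kernel

set_option maxRecDepth 100000 in
lemma mul_quotCofactor : mul 0 quotCoeffs quotCofactor (deriv (quotCoeffs ++ [1])) =
    [quotInt] ++ List.replicate 23 0 := by
  decide +kernel

set_option maxRecDepth 100000 in
lemma mul_altCofactor : mul 0 altCoeffs altCofactor (deriv (altCoeffs ++ [1])) =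
    [altInt] ++ List.replicate 23 0 := by
  decide +kernel

set_option maxRecDepth 100000 in
lemma sqrtCoeffs_sq :
    ∀ c ∈ addMul 0 (-1) (mul 0 quotCoeffs sqrtCoeffs sqrtCoeffs) [0, 1], c % 4 = 0 := by
  decide +kernel

lemma gcd_quotInt_altInt : Int.gcd quotInt altInt = 11 ^ 7 := by
  decide +kernel

end CoeffList

section Ramification

open NumberField IntermediateField

lemma aeval_derivative_mem_differentIdeal_of_aeval_eq_zero (A K L B : Type*) [CommRing A]
    [IsDedekindDomain A] [Field K] [Algebra A K] [IsFractionRing A K] [CommRing B]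
    [IsDedekindDomain B] [Field L] [Algebra B L] [IsFractionRing B L] [Algebra A B] [Algebra K L]
    [Algebra A L] [IsScalarTower A K L] [IsScalarTower A B L] [Module.IsTorsionFree A B]
    [Module.Finite A B] [FiniteDimensional K L] [Algebra.IsSeparable K L]
    [IsIntegralClosure B A L]
    (x : B) (hx : K⟮algebraMap B L x⟯ = ⊤) (P : A[X]) (hP : aeval x P = 0) :
    aeval x (derivative P) ∈ differentIdeal A B := by
  obtain ⟨Q, hQ⟩ := minpoly.isIntegrallyClosed_dvd (Algebra.IsIntegral.isIntegral x) hP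
  have hadj : Algebra.adjoin K {algebraMap B L x} = ⊤ := by
    rw [← adjoin_simple_toSubalgebra_of_isAlgebraic (Algebra.IsAlgebraic.isAlgebraic _), hx,
      top_toSubalgebra]
  rw [hQ, derivative_mul, map_add, map_mul, map_mul, minpoly.aeval, zero_mul, add_zero]
  exact Ideal.mul_mem_right _ _ (aeval_derivative_mem_differentIdeal A K L x hadj)

lemma adjoin_gen_eq_top (F : Type*) {E : Type*} [Field F] [Field E] [Algebra F E] (x : E) :
    F⟮AdjoinSimple.gen F x⟯ = ⊤ := by
  apply lift_injective
  rw [lift_adjoin_simple, lift_top, AdjoinSimple.coe_gen]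

lemma Ideal.gcd_mem {R : Type*} [CommRing R] {I : Ideal R} {m n : ℤ} (hm : (m : R) ∈ I)
    (hn : (n : R) ∈ I) : ((Int.gcd m n : ℕ) : R) ∈ I := by
  rw [← Int.cast_natCast, Int.gcd_eq_gcd_ab]
  push_cast
  exact I.add_mem (I.mul_mem_right _ hm) (I.mul_mem_right _ hn)

lemma eq_of_prime_dvd_absNorm {K : Type*} [Field K] [NumberField K] {I : Ideal (𝓞 K)} {q n : ℕ}
    (hq : q.Prime) (hI : ((q ^ n : ℕ) : 𝓞 K) ∈ I) {p : ℕ} (hp : p.Prime) (h : p ∣ I.absNorm) :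
    p = q := by
  have h' := (Int.natCast_dvd_natCast.mpr h).trans (Ideal.absNorm_dvd_norm_of_mem hI)
  rw [← map_natCast (algebraMap ℤ (𝓞 K)), Algebra.norm_algebraMap] at h'
  have h'' : p ∣ (q ^ n) ^ Module.finrank ℤ (𝓞 K) := by exact_mod_cast h'
  exact (Nat.prime_dvd_prime_iff_eq hp hq).mp (hp.dvd_of_dvd_pow (hp.dvd_of_dvd_pow h''))

/-- The derivative of a quadratic polynomial at a root generating an extension lies in the
different. -/
lemma two_mul_add_mem_differentIdeal {L K : Type*} [Field L] [NumberField L] [Field K]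
    [NumberField K] [Algebra L K] {b c : 𝓞 L} {w : K}
    (hw : w ^ 2 + algebraMap L K b * w + algebraMap L K c = 0) (htop : L⟮w⟯ = ⊤) :
    ∃ v : 𝓞 K, (v : K) = w ∧ 2 * v + algebraMap (𝓞 L) (𝓞 K) b ∈
      differentIdeal (𝓞 L) (𝓞 K) := by
  have hint : IsIntegral (𝓞 L) w := by
    refine ⟨X ^ 2 + C b * X + C c, by monicity!, ?_⟩
    simpa [IsScalarTower.algebraMap_apply (𝓞 L) L K] using hw
  set v : 𝓞 K := ⟨w, isIntegral_trans w hint⟩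
  have hvw : (v : K) = w := rfl
  have hcoe (a : 𝓞 L) : (algebraMap (𝓞 L) (𝓞 K) a : K) = algebraMap L K a := rfl
  refine ⟨v, rfl, ?_⟩
  have h := aeval_derivative_mem_differentIdeal_of_aeval_eq_zero (𝓞 L) L K (𝓞 K) v htop
    (X ^ 2 + C b * X + C c) (by
      apply RingOfIntegers.coe_injective
      simpa [hcoe, hvw] using hw)
  simpa [two_mul, add_mul] using h

namespace CoeffList

lemma isIntegral_of_eval_eq_zero {R : Type*} [CommRing R] {x : R} {F : List ℤ}
    (hF : eval x F + x ^ F.length = 0) : IsIntegral ℤ x := by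
  refine ⟨eval X F + X ^ F.length, monic_eval_X_add ℤ F, ?_⟩
  rw [eval₂_add, ← coe_eval₂RingHom, map_eval]
  simpa using hF

lemma eval_deriv_mem_differentIdeal {L : Type*} [Field L] [NumberField L] {x : 𝓞 L} {l : List ℤ}
    (hl : eval x l = 0) (htop : ℚ⟮(x : L)⟯ = ⊤) : eval x (deriv l) ∈ differentIdeal ℤ (𝓞 L) := by
  have h := aeval_derivative_mem_differentIdeal_of_aeval_eq_zero ℤ ℚ L (𝓞 L) x htop (eval X l)
    (by rw [aeval_eval, hl])
  rwa [derivative_eval, aeval_eval] at h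

lemma intCast_mem_differentIdeal {L : Type*} [Field L] [NumberField L] {x : 𝓞 L} {F u : List ℤ}
    (hF : eval x F + x ^ F.length = 0) (htop : ℚ⟮(x : L)⟯ = ⊤) {n : ℤ} {k : ℕ}
    (hu : mul 0 F u (deriv (F ++ [1])) = [n] ++ List.replicate k 0) :
    (n : 𝓞 L) ∈ differentIdeal ℤ (𝓞 L) := by
  have h := eval_mul Int.cast_zero hF u (deriv (F ++ [1]))
  rw [hu, eval_append, eval_replicate_zero] at h
  have hn : (n : 𝓞 L) = eval x u * eval x (deriv (F ++ [1])) := by simpa using h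
  rw [hn]
  refine Ideal.mul_mem_left _ _ (eval_deriv_mem_differentIdeal ?_ htop)
  simpa [eval_append] using hF

lemma eval_mem {K L : Type*} [Field K] [Field L] [Algebra K L] (E : IntermediateField K L)
    {x : L} (hx : x ∈ E) (l : List ℤ) : eval x l ∈ E := by
  have h := map_eval (⟨x, hx⟩ : E) (algebraMap E L) l
  rw [show algebraMap E L ⟨x, hx⟩ = x from rfl] at h
  rw [← h]
  exact SetLike.coe_mem _

lemma eval_map_div {R : Type*} [CommRing R] {x : R} {m : ℤ} {l : List ℤ}
    (h : ∀ c ∈ l, c % m = 0) : eval x l = m * eval x (l.map (· / m)) := by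
  induction l with
  | nil => simp
  | cons c l ih =>
    have hc : (c : R) = m * (c / m : ℤ) := by
      rw [← Int.cast_mul, Int.mul_ediv_cancel' (Int.dvd_of_emod_eq_zero (h c (by simp)))]
    simp only [List.map_cons, eval_cons, ih fun b hb => h b (by simp [hb])]
    rw [hc]
    ring

end CoeffList

namespace CoeffList

theorem eq_eleven_of_dvd_discr {L : Type*} [Field L] [NumberField L] {x : L}
    (hx : eval x quotCoeffs + x ^ 24 = 0) (htop : ℚ⟮x⟯ = ⊤) {p : ℕ} (hp : p.Prime)
    (hdvd : (p : ℤ) ∣ discr L) : p = 11 := by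
  have hDen : (altDen : L) ≠ 0 := Int.cast_ne_zero.mpr (by decide)
  have hBack : (backDen : L) ≠ 0 := Int.cast_ne_zero.mpr (by decide)
  set z : L := eval x altNum / altDen with hz
  have hnum : eval x altNum = altDen * z := by rw [hz, mul_div_cancel₀ _ hDen]
  have hz0 : eval z altCoeffs + z ^ 24 = 0 := by
    have h := eval_homComp hx hnum (altCoeffs ++ [1])
    rw [eval_eq_zero x homComp_altNum, mul_zero, eval_append] at h
    have h' := (mul_eq_zero.mp h.symm).resolve_left (pow_ne_zero _ hDen)
    simpa [show altCoeffs.length = 24 from rfl] using h'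
  have hback : backDen * x = eval z backNum := by
    have h := eval_homComp hx hnum backNum
    rw [homComp_backNum, eval_append, eval_replicate_zero] at h
    apply mul_left_cancel₀ (pow_ne_zero 24 hDen)
    rw [show (altDen : L) ^ 24 = altDen ^ backNum.length from rfl, ← h]
    simp only [eval_cons, eval_nil]
    push_cast
    rw [show backNum.length = 24 from rfl]
    ring
  have hztop : ℚ⟮z⟯ = ⊤ := by
    rw [eq_top_iff, ← htop, adjoin_simple_le_iff, ← mul_div_cancel_left₀ x hBack, hback]
    exact div_mem (eval_mem _ (mem_adjoin_simple_self ℚ z) _) (intCast_mem _ _)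
  obtain ⟨x', rfl⟩ : ∃ x' : 𝓞 L, (x' : L) = x :=
    ⟨⟨x, isIntegral_of_eval_eq_zero (F := quotCoeffs) hx⟩, rfl⟩
  obtain ⟨z', hz'⟩ : ∃ z' : 𝓞 L, (z' : L) = z :=
    ⟨⟨z, isIntegral_of_eval_eq_zero (F := altCoeffs) hz0⟩, rfl⟩
  have hx' : eval x' quotCoeffs + x' ^ quotCoeffs.length = 0 := by
    apply RingOfIntegers.coe_injective
    rw [map_add, map_eval, map_pow, map_zero]
    exact hx
  have hz0' : eval z' altCoeffs + z' ^ altCoeffs.length = 0 := by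
    apply RingOfIntegers.coe_injective
    rw [map_add, map_eval, map_pow, map_zero, show algebraMap (𝓞 L) L z' = z from hz']
    exact hz0
  have hmem := Ideal.gcd_mem (intCast_mem_differentIdeal hx' htop mul_quotCofactor)
    (intCast_mem_differentIdeal hz0' (by rwa [hz']) mul_altCofactor)
  rw [gcd_quotInt_altInt] at hmem
  refine eq_of_prime_dvd_absNorm (by norm_num) hmem hp ?_
  rw [absNorm_differentIdeal L]
  exact Int.natCast_dvd.mp hdvd

theorem eq_eleven_of_dvd_absNorm_differentIdeal {L K : Type*} [Field L] [NumberField L] [Field K]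
    [NumberField K] [Algebra L K] {x : L} {y : K} (hx : eval x quotCoeffs + x ^ 24 = 0)
    (hy : y ^ 2 = algebraMap L K x) (htop : L⟮y⟯ = ⊤) {p : ℕ} (hp : p.Prime)
    (hdvd : p ∣ (differentIdeal (𝓞 L) (𝓞 K)).absNorm) : p = 11 := by
  obtain ⟨x, rfl⟩ : ∃ x' : 𝓞 L, (x' : L) = x :=
    ⟨⟨x, isIntegral_of_eval_eq_zero (F := quotCoeffs) hx⟩, rfl⟩
  have hx' : eval x quotCoeffs + x ^ quotCoeffs.length = 0 := by
    apply RingOfIntegers.coe_injective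
    rw [map_add, map_eval, map_pow, map_zero]
    exact hx
  set b : 𝓞 L := eval x sqrtCoeffs
  obtain ⟨c, hc⟩ : ∃ c : 𝓞 L, b ^ 2 - x = 4 * c := by
    have h := eval_map_div (x := x) sqrtCoeffs_sq
    rw [eval_addMul_zero, eval_mul Int.cast_zero hx'] at h
    rw [Int.cast_ofNat] at h
    refine ⟨_, Eq.trans ?_ h⟩
    simp [b]
    ring
  set d : 𝓞 L := eval x (quotCoeffs.tail ++ [1])
  have hd : 4053179721535836749649 + x * d = 0 := by
    have h : eval x (quotCoeffs ++ [1]) = 0 := by simpa [eval_append] using hx'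
    rwa [quotCoeffs, List.cons_append, eval_cons, Int.cast_ofNat] at h
  obtain ⟨t, ht⟩ : ∃ t : 𝓞 L, d = 958970862252751000070 + x * t := by
    refine ⟨eval x (quotCoeffs.tail.tail ++ [1]), ?_⟩
    simp [d, quotCoeffs]
  have hd0 : algebraMap L K d ≠ 0 := by
    intro h
    have : d = 0 := by simpa using h
    rw [this] at hd
    norm_num at hd
  have htop_of {w : K} (h : y ∈ L⟮w⟯) : L⟮w⟯ = ⊤ := by
    rwa [eq_top_iff, ← htop, adjoin_simple_le_iff]
  have hmem (w : K) (a : L) : algebraMap L K a ∈ L⟮w⟯ := IntermediateField.algebraMap_mem _ a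
  have hcK := congrArg (fun a : 𝓞 L => algebraMap L K a) hc
  have hdK := congrArg (fun a : 𝓞 L => algebraMap L K a) hd
  simp only [map_sub, map_mul, map_pow, map_add, map_ofNat, map_zero] at hcK hdK
  have hcoe (a : 𝓞 L) : (algebraMap (𝓞 L) (𝓞 K) a : K) = algebraMap L K a := rfl
  obtain ⟨v, hv, hvD⟩ := two_mul_add_mem_differentIdeal (L := L) (b := -b) (c := c)
    (w := (y + algebraMap L K b) / 2) (by
      simp only [map_neg]
      linear_combination (1 / 4 : K) * hy - (1 / 4 : K) * hcK) (htop_of (by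
      have h := sub_mem (add_mem (mem_adjoin_simple_self L ((y + algebraMap L K b) / 2))
        (mem_adjoin_simple_self L ((y + algebraMap L K b) / 2))) (hmem _ (b : L))
      convert h using 1
      ring))
  obtain ⟨u, hu, huD⟩ := two_mul_add_mem_differentIdeal (L := L) (b := 0) (c := 11 ^ 18 * d)
    (w := algebraMap L K d * y / 27) (by
      simp only [map_zero, map_mul, map_pow, map_ofNat]
      linear_combination (1 / 729 : K) * algebraMap L K d ^ 2 * hy +
        (1 / 729 : K) * algebraMap L K d * hdK) (htop_of (by
      have h := div_mem (mul_mem (mem_adjoin_simple_self L (algebraMap L K d * y / 27))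
        (ofNat_mem _ 27)) (hmem (algebraMap L K d * y / 27) (d : L))
      convert h using 1
      field_simp))
  set D := differentIdeal (𝓞 L) (𝓞 K)
  set φ := algebraMap (𝓞 L) (𝓞 K)
  have hvx : (2 * v + φ (-b)) * (2 * v + φ (-b)) = φ x := by
    apply RingOfIntegers.coe_injective
    simp only [map_mul, map_add, map_neg, hv, map_ofNat, φ, hcoe]
    linear_combination hy
  have hud : (2 * u + φ 0) * (2 * u + φ 0) = -4 * 11 ^ 18 * φ d := by
    apply RingOfIntegers.coe_injective
    simp only [map_mul, map_add, map_neg, map_pow, hu, map_ofNat, map_zero, φ, hcoe]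
    linear_combination (4 / 729 : K) * algebraMap L K d ^ 2 * hy +
      (4 / 729 : K) * algebraMap L K d * hdK
  have hxD : φ x ∈ D := hvx ▸ D.mul_mem_left _ hvD
  have hdD := hud ▸ D.mul_mem_left (2 * u + φ 0) huD
  have h₁ : ((4053179721535836749649 : ℤ) : 𝓞 K) ∈ D := by
    have h := congrArg φ hd
    simp only [map_add, map_mul, map_ofNat, map_zero] at h
    rw [Int.cast_ofNat, eq_neg_of_add_eq_zero_left h]
    exact neg_mem (D.mul_mem_right _ hxD)
  have h₂ : ((4 * 11 ^ 18 * 958970862252751000070 : ℤ) : 𝓞 K) ∈ D := by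
    have h := congrArg φ ht
    simp only [map_add, map_mul, map_ofNat] at h
    have h' := sub_mem (neg_mem hdD) (D.mul_mem_left (4 * 11 ^ 18 * φ t) hxD)
    convert h' using 1
    push_cast
    linear_combination -4 * 11 ^ 18 * h
  have h := Ideal.gcd_mem h₁ h₂
  rw [show Int.gcd 4053179721535836749649 (4 * 11 ^ 18 * 958970862252751000070) = 11 ^ 18 by
    decide +kernel] at h
  exact eq_of_prime_dvd_absNorm (by norm_num) h hp hdvd

theorem eq_eleven_of_dvd_discr_of_sq {K : Type*} [Field K] [NumberField K] {y : K}
    (hy : eval (y ^ 2) quotCoeffs + (y ^ 2) ^ 24 = 0) (htop : ℚ⟮y⟯ = ⊤) {p : ℕ} (hp : p.Prime)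
    (hdvd : (p : ℤ) ∣ discr K) : p = 11 := by
  set L := ℚ⟮y ^ 2⟯
  have hx : eval (AdjoinSimple.gen ℚ (y ^ 2)) quotCoeffs + AdjoinSimple.gen ℚ (y ^ 2) ^ 24 = 0 := by
    apply (algebraMap L K).injective
    rw [map_add, map_eval, map_pow, map_zero, AdjoinSimple.algebraMap_gen]
    exact hy
  have hxtop : ℚ⟮AdjoinSimple.gen ℚ (y ^ 2)⟯ = ⊤ :=
    adjoin_gen_eq_top ℚ (y ^ 2)
  have hytop : L⟮y⟯ = ⊤ := by
    rw [← restrictScalars_eq_top_iff (K := ℚ), eq_top_iff, ← htop, adjoin_simple_le_iff]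
    exact mem_adjoin_simple_self L y
  rw [← Int.dvd_natAbs, Int.natCast_dvd_natCast,
    natAbs_discr_eq_absNorm_differentIdeal_mul_natAbs_discr_pow L (𝓞 L) K (𝓞 K),
    hp.dvd_mul] at hdvd
  obtain h | h := hdvd
  · exact eq_eleven_of_dvd_absNorm_differentIdeal hx (AdjoinSimple.algebraMap_gen ℚ _).symm hytop
      hp h
  · exact eq_eleven_of_dvd_discr hx hxtop hp (Int.natCast_dvd.mpr (hp.dvd_of_dvd_pow h))

end CoeffList

end Ramification

/-- With `e = 11`, the degree-48 polynomial `g(y)` below is irreducible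
over `ℚ`, and the number field `ℚ[y]/(g)` (i.e. any number field generated by a root of `g`)
is ramified only at `11`: every prime dividing its discriminant equals `11`. -/
theorem g_irreducible_and_ramified_only_at_11 :
    let e : ℚ := 11
    let g : Polynomial ℚ :=
      X ^ 48 + C (2 * e ^ 3) * X ^ 42 + C (69 * e ^ 5) * X ^ 36 + C (868 * e ^ 7) * X ^ 30
        - C (4174 * e ^ 7) * X ^ 26 + C (11287 * e ^ 9) * X ^ 24 - C (4174 * e ^ 10) * X ^ 20
        + C (5340 * e ^ 12) * X ^ 18 + C (131481 * e ^ 12) * X ^ 14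
        + C (17599 * e ^ 14) * X ^ 12 + C (530098 * e ^ 14) * X ^ 8
        + C (3910 * e ^ 16) * X ^ 6 + C (4355569 * e ^ 14) * X ^ 4
        + C (20870 * e ^ 16) * X ^ 2 + C (729 * e ^ 18)
    Irreducible g ∧
      ∀ (K : Type) [Field K] [NumberField K] (y : K),
        Polynomial.aeval y g = 0 → IntermediateField.adjoin ℚ {y} = ⊤ →
        ∀ p : ℕ, p.Prime → (p : ℤ) ∣ NumberField.discr K → p = 11 := by
  intro e g
  have hg : g = CoeffList.eval (X ^ 2) (CoeffList.quotCoeffs ++ [1]) := by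
    simp only [g, e, CoeffList.quotCoeffs, List.cons_append, List.nil_append, CoeffList.eval_cons,
      CoeffList.eval_nil]
    simp only [map_mul, map_pow, map_ofNat]
    push_cast
    ring
  have hgZ : g = (CoeffList.eval (X ^ 2) (CoeffList.quotCoeffs ++ [1]) : ℤ[X]).map
      (algebraMap ℤ ℚ) := by
    rw [← coe_mapRingHom, CoeffList.map_eval, map_pow, coe_mapRingHom, map_X, hg]
  refine ⟨?_, fun K _ _ y hy htop p hp hdvd => ?_⟩
  · rw [hgZ, ← (CoeffList.monic_eval_sq ℤ).irreducible_iff_irreducible_map_fraction_map]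
    exact CoeffList.irreducible_eval_sq
  · refine CoeffList.eq_eleven_of_dvd_discr_of_sq (y := y) ?_ htop hp hdvd
    rw [hg, ← AlgHom.coe_toRingHom, CoeffList.map_eval, CoeffList.eval_append] at hy
    simpa [CoeffList.quotCoeffs] using hy
end

section
/- Let u be a square root of -11 and set τ = 2087^3/(2^6·3^15·11) ∈ ℚ. Let f_D(τ,x) = -11^2·u·(1188u·x^3 + 198u·x^2 - 1346u·x - 27u + 594x^4 - 7920x^2 - 1474x + 135)^3 - 2^8·3^13·(253u - 67)·τ·x and let h(x) = f_D(τ,x)·f̄_D(τ,x) ∈ ℚ[x], where f̄_D is obtained by replacing u by -u. Then h is irreducible of degree 24 over ℚ, and the number field K = ℚ[x]/(h) has discriminant of absolute value 11^44. -/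
open Polynomial NumberField

/-- The value at `a` of the polynomial with the given coefficients, constant term first. -/
def evalList {R : Type} [CommRing R] (a : R) : List ℤ → R
  | [] => 0
  | c :: l => c + a * evalList a l

/-- Coefficientwise sum. -/
def addList : List ℤ → List ℤ → List ℤ
  | [], m => m
  | c :: l, [] => c :: l
  | c :: l, d :: m => (c + d) :: addList l m

/-- Coefficientwise product with an integer. -/
def smulList (c : ℤ) (l : List ℤ) : List ℤ := l.map (c * ·)

/-- Coefficients of the product of two polynomials. -/
def mulList : List ℤ → List ℤ → List ℤ
  | [], _ => []
  | c :: l, v => addList (smulList c v) (0 :: mulList l v)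

/-- Coefficients of the derivative. -/
def derivList : List ℤ → List ℤ
  | [] => []
  | _ :: l => addList l (0 :: derivList l)

/-- Multiplication by the variable modulo the monic polynomial with lower coefficients `t`. -/
def shiftMod (t v : List ℤ) : List ℤ :=
  match v.drop (t.length - 1) with
  | [c] => addList (0 :: v.take (t.length - 1)) (smulList (-c) t)
  | _ => 0 :: v

/-- Multiplication modulo the monic polynomial with lower coefficients `t`. -/
def mulMod (t : List ℤ) : List ℤ → List ℤ → List ℤ
  | [], _ => []
  | c :: l, v => addList (smulList c v) (shiftMod t (mulMod t l v))

section evalList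

variable {R S : Type} [CommRing R] [CommRing S]

theorem map_evalList (f : R →+* S) (a : R) (l : List ℤ) :
    f (evalList a l) = evalList (f a) l := by
  induction l with
  | nil => simp [evalList]
  | cons c l ih => simp [evalList, ih]

theorem aeval_evalList (a : R) (l : List ℤ) : aeval a (evalList (X : ℤ[X]) l) = evalList a l := by
  simpa using map_evalList (aeval a : ℤ[X] →ₐ[ℤ] R).toRingHom X l

theorem eval_evalList (a : ℤ) (l : List ℤ) : (evalList (X : ℤ[X]) l).eval a = evalList a l := by
  simpa using map_evalList (evalRingHom a) X l

theorem evalList_addList (a : R) (l m : List ℤ) :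
    evalList a (addList l m) = evalList a l + evalList a m := by
  induction l generalizing m with
  | nil => simp [evalList, addList]
  | cons c l ih =>
    cases m with
    | nil => simp [evalList, addList]
    | cons d m => simp [evalList, addList, ih]; ring

theorem evalList_smulList (a : R) (c : ℤ) (l : List ℤ) :
    evalList a (smulList c l) = c * evalList a l := by
  induction l with
  | nil => simp [evalList, smulList]
  | cons d l ih =>
    simp only [smulList, List.map_cons, evalList] at ih ⊢
    rw [ih]; push_cast; ring

theorem evalList_mulList (a : R) (l m : List ℤ) :
    evalList a (mulList l m) = evalList a l * evalList a m := by
  induction l with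
  | nil => simp [evalList, mulList]
  | cons c l ih =>
    simp [evalList, mulList, evalList_addList, evalList_smulList, ih]; ring

theorem evalList_append (a : R) (l m : List ℤ) :
    evalList a (l ++ m) = evalList a l + a ^ l.length * evalList a m := by
  induction l with
  | nil => simp [evalList]
  | cons c l ih => simp [evalList, ih, pow_succ]; ring

theorem derivative_evalList (l : List ℤ) :
    derivative (evalList (X : ℤ[X]) l) = evalList X (derivList l) := by
  induction l with
  | nil => simp [evalList, derivList]
  | cons c l ih => simp [evalList, derivList, evalList_addList, ih]

theorem evalList_shiftMod {a : R} {t : List ℤ} (ht : t ≠ [])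
    (ha : evalList a (t ++ [1]) = 0) (v : List ℤ) :
    evalList a (shiftMod t v) = a * evalList a v := by
  unfold shiftMod
  split
  · rename_i c hc
    have hpos := List.length_pos_iff.mpr ht
    have h1 := evalList_append a (v.take (t.length - 1)) (v.drop (t.length - 1))
    rw [List.take_append_drop, hc] at h1
    have hlen : (v.take (t.length - 1)).length = t.length - 1 := by
      have := congrArg List.length hc
      simp only [List.length_drop, List.length_singleton] at this
      simp only [List.length_take]
      omega
    rw [hlen] at h1
    rw [evalList_append] at ha
    simp only [evalList, Int.cast_one, mul_zero, add_zero, mul_one] at h1 ha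
    rw [evalList_addList, evalList_smulList, h1]
    obtain ⟨n, hn⟩ := Nat.exists_eq_add_of_lt hpos
    rw [hn] at ha ⊢
    simp only [evalList, Int.cast_zero, zero_add, Nat.add_sub_cancel, Int.cast_neg] at ha ⊢
    rw [pow_succ] at ha
    linear_combination (-(c : R)) * ha
  · simp [evalList]

theorem evalList_mulMod {a : R} {t : List ℤ} (ht : t ≠ [])
    (ha : evalList a (t ++ [1]) = 0) (l v : List ℤ) :
    evalList a (mulMod t l v) = evalList a l * evalList a v := by
  induction l with
  | nil => simp [evalList, mulMod]
  | cons c l ih =>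
    simp only [evalList, mulMod, evalList_addList, evalList_smulList, evalList_shiftMod ht ha, ih]
    ring

theorem evalList_eq_zero_of_all (a : R) {l : List ℤ} (h : l.all (· == 0) = true) :
    evalList a l = 0 := by
  induction l with
  | nil => rfl
  | cons c l ih =>
    simp only [List.all_cons, Bool.and_eq_true, beq_iff_eq] at h
    simp [evalList, h.1, ih h.2]

theorem evalList_smul_div (a : R) (n : ℤ) {l : List ℤ} (h : l.all (n ∣ ·) = true) :
    evalList a l = n * evalList a (l.map (· / n)) := by
  induction l with
  | nil => simp [evalList]
  | cons c l ih =>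
    simp only [List.all_cons, Bool.and_eq_true, decide_eq_true_eq] at h
    simp only [evalList, List.map_cons, ih h.2]
    obtain ⟨d, rfl⟩ := h.1
    by_cases hn : n = 0
    · simp [hn]
    · rw [Int.mul_ediv_cancel_left _ hn]; push_cast; ring

end evalList

theorem degree_evalList_lt (l : List ℤ) :
    (evalList (X : ℤ[X]) l).degree < (l.length : WithBot ℕ) := by
  induction l with
  | nil => simp [evalList]
  | cons c l ih =>
    rw [evalList, ← C_eq_intCast, List.length_cons]
    refine (degree_add_le _ _).trans_lt (max_lt (degree_C_le.trans_lt ?_) ?_)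
    · exact_mod_cast Nat.succ_pos _
    · rw [degree_mul, degree_X, add_comm]
      by_cases h0 : evalList (X : ℤ[X]) l = 0
      · simp [h0]
      · rw [degree_eq_natDegree h0] at ih ⊢
        have : (evalList (X : ℤ[X]) l).natDegree < l.length := by exact_mod_cast ih
        exact_mod_cast Nat.succ_lt_succ this

theorem evalList_append_one (t : List ℤ) :
    evalList (X : ℤ[X]) (t ++ [1]) = X ^ t.length + evalList X t := by
  rw [evalList_append]; simp [evalList]; ring

theorem monic_evalList_append_one (t : List ℤ) : (evalList (X : ℤ[X]) (t ++ [1])).Monic := by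
  rw [evalList_append_one]
  exact monic_X_pow_add (degree_evalList_lt t)

theorem natDegree_evalList_append_one (t : List ℤ) :
    (evalList (X : ℤ[X]) (t ++ [1])).natDegree = t.length := by
  rw [evalList_append_one]
  rw [natDegree_add_eq_left_of_degree_lt (by rw [degree_X_pow]; exact degree_evalList_lt t),
    natDegree_X_pow]

theorem coeff_evalList (l : List ℤ) (i : ℕ) : (evalList (X : ℤ[X]) l).coeff i = l.getD i 0 := by
  induction l generalizing i with
  | nil => simp [evalList]
  | cons c l ih =>
    cases i with
    | zero => simp [evalList]
    | succ i =>
      rw [evalList, coeff_add, coeff_X_mul, ih, ← C_eq_intCast, coeff_C]; simp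

/-- Value in `k[ρ]`, `ρ² = q + s ρ`, of a polynomial at `ρ`, in the basis `1, ρ`. -/
def pairEval {k : Type} [CommRing k] (q s : k) : List ℤ → k × k
  | [] => (0, 0)
  | c :: l => (c + q * (pairEval q s l).2, (pairEval q s l).1 + s * (pairEval q s l).2)

theorem evalList_eq_pairEval {k A : Type} [CommRing k] [CommRing A] [Algebra k A] (q s : k) (ρ : A)
    (hρ : ρ ^ 2 = algebraMap k A q + algebraMap k A s * ρ) (l : List ℤ) :
    evalList ρ l = algebraMap k A (pairEval q s l).1 + algebraMap k A (pairEval q s l).2 * ρ := by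
  induction l with
  | nil => simp [evalList, pairEval]
  | cons c l ih =>
    simp only [evalList, pairEval, ih, map_add, map_mul, map_intCast]
    linear_combination (algebraMap k A (pairEval q s l).2) * hρ

theorem natDegree_ne_one_of_dvd (p : ℕ) [Fact p.Prime] {l : List ℤ}
    (hl : ∀ r : ZMod p, evalList r l ≠ 0) {g : ℤ[X]} (hg : g.Monic)
    (hd : g ∣ evalList X l) : g.natDegree ≠ 1 := by
  intro h1
  rw [hg.eq_X_add_C h1] at hd
  obtain ⟨f, hf⟩ := hd
  apply hl (-(g.coeff 0 : ZMod p))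
  have := map_evalList (eval₂RingHom (Int.castRingHom (ZMod p)) (-(g.coeff 0 : ZMod p)))
    (X : ℤ[X]) l
  have h4 : eval₂RingHom (Int.castRingHom (ZMod p)) (-(g.coeff 0 : ZMod p))
      (X + C (g.coeff 0)) = 0 := by
    rw [coe_eval₂RingHom, eval₂_add, eval₂_X, eval₂_C, eq_intCast, neg_add_cancel]
  rw [hf, map_mul, h4, zero_mul] at this
  simpa using this.symm

theorem natDegree_ne_two_of_dvd (p : ℕ) [Fact p.Prime] {l : List ℤ}
    (hl : ∀ q s : ZMod p, pairEval q s l ≠ (0, 0)) {g : ℤ[X]} (hg : g.Monic)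
    (hd : g ∣ evalList X l) : g.natDegree ≠ 2 := by
  intro h2
  set G := g.map (Int.castRingHom (ZMod p)) with hG
  have hGm : G.Monic := hg.map _
  have hG2 : G.natDegree = 2 := by rw [hG, hg.natDegree_map, h2]
  have hGe : G = X ^ 2 + C (G.coeff 1) * X + C (G.coeff 0) := by
    conv_lhs => rw [hGm.as_sum, hG2]
    simp [Finset.sum_range_succ]; ring
  set ρ := AdjoinRoot.root G
  have hρ : ρ ^ 2 = algebraMap (ZMod p) (AdjoinRoot G) (-G.coeff 0) +
      algebraMap (ZMod p) (AdjoinRoot G) (-G.coeff 1) * ρ := by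
    have : AdjoinRoot.mk G (X ^ 2 + C (G.coeff 1) * X + C (G.coeff 0)) = 0 := by
      rw [← hGe]
      exact AdjoinRoot.mk_self
    rw [map_add, map_add, map_mul, map_pow, AdjoinRoot.mk_C, AdjoinRoot.mk_C, AdjoinRoot.mk_X]
      at this
    rw [AdjoinRoot.algebraMap_eq, map_neg, map_neg]
    linear_combination this
  have h0 : evalList ρ l = 0 := by
    have h3 := map_evalList (eval₂RingHom (Int.castRingHom (AdjoinRoot G)) ρ) (X : ℤ[X]) l
    obtain ⟨f, hf⟩ := hd
    rw [hf, map_mul] at h3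
    have h4 : eval₂RingHom (Int.castRingHom (AdjoinRoot G)) ρ g = 0 := by
      have := AdjoinRoot.eval₂_root G
      rw [hG, eval₂_map] at this
      rw [coe_eval₂RingHom]
      convert this using 2
      exact RingHom.ext_int _ _
    rw [h4, zero_mul] at h3
    simpa using h3.symm
  rw [evalList_eq_pairEval _ _ ρ hρ] at h0
  set u := pairEval (-G.coeff 0) (-G.coeff 1) l with hu
  have h5 : AdjoinRoot.mk G (C u.2 * X + C u.1) = 0 := by
    rw [map_add, map_mul, AdjoinRoot.mk_C, AdjoinRoot.mk_C, AdjoinRoot.mk_X,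
      ← AdjoinRoot.algebraMap_eq, add_comm]
    exact h0
  rw [AdjoinRoot.mk_eq_zero] at h5
  have h6 : C u.2 * X + C u.1 = 0 := by
    apply eq_zero_of_dvd_of_natDegree_lt h5
    rw [hG2]
    exact natDegree_linear_le.trans_lt one_lt_two
  apply hl (-G.coeff 0) (-G.coeff 1)
  have e1 := congrArg (coeff · 1) h6
  have e0 := congrArg (coeff · 0) h6
  simp at e1 e0
  exact Prod.ext e0 e1

theorem irreducible_of_map_eq_pow_mul_pow (p : ℕ) [Fact p.Prime] {P : ℤ[X]} (hP : P.Monic)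
    {m n : ℕ} {a b : ℤ} (hmn : 2 * n < m + n) (hdeg : P.natDegree = m + n)
    (hmap : P.map (Int.castRingHom (ZMod p)) =
      ((X - C a) ^ m * (X - C b) ^ n : ℤ[X]).map (Int.castRingHom (ZMod p)))
    (ha : ¬ (p : ℤ) ^ 2 ∣ P.eval a)
    (hlow : ∀ g : ℤ[X], g.Monic → g ∣ P → 0 < g.natDegree → n < g.natDegree) :
    Irreducible P := by
  have hmap' : P.map (Int.castRingHom (ZMod p)) =
      (X - C (a : ZMod p)) ^ m * (X - C (b : ZMod p)) ^ n := by rw [hmap]; simp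
  have key : ∀ f : ℤ[X], f.Monic → f ∣ P → ¬ (p : ℤ) ∣ f.eval a → f.natDegree ≤ n := by
    intro f hf hfP hfa
    have h1 : IsCoprime (f.map (Int.castRingHom (ZMod p))) ((X - C (a : ZMod p)) ^ m) := by
      apply IsCoprime.symm
      apply IsCoprime.pow_left
      rw [(irreducible_X_sub_C _).coprime_iff_not_dvd, dvd_iff_isRoot, IsRoot.def]
      have h1 : eval ((Int.castRingHom (ZMod p)) a) (f.map (Int.castRingHom (ZMod p))) =
        (Int.castRingHom (ZMod p)) (f.eval a) := eval_map_apply _ _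
      rw [eq_intCast, eq_intCast] at h1
      rwa [h1, ZMod.intCast_zmod_eq_zero_iff_dvd]
    have h2 : f.map (Int.castRingHom (ZMod p)) ∣ P.map (Int.castRingHom (ZMod p)) :=
      Polynomial.map_dvd _ hfP
    rw [hmap'] at h2
    have h3 := natDegree_le_of_dvd (h1.dvd_of_dvd_mul_left h2)
      (pow_ne_zero _ (X_sub_C_ne_zero _))
    rwa [natDegree_pow, natDegree_X_sub_C, mul_one, hf.natDegree_map] at h3
  rw [hP.irreducible_iff_natDegree']
  refine ⟨fun h => ?_, ?_⟩
  · rw [h, natDegree_one] at hdeg; omega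
  intro f g hf hg hfg hgd
  rw [Finset.mem_Ioc] at hgd
  have hg' := hlow g hg ⟨f, by rw [← hfg, mul_comm]⟩ hgd.1
  have hsum : f.natDegree + g.natDegree = m + n := by
    rw [← hdeg, ← hfg, hf.natDegree_mul hg]
  have hfn : n < f.natDegree := by omega
  have hga : (p : ℤ) ∣ g.eval a := by
    by_contra h
    exact absurd (key g hg ⟨f, by rw [← hfg, mul_comm]⟩ h) (by omega)
  have hfa : (p : ℤ) ∣ f.eval a := by
    by_contra h
    exact absurd (key f hf ⟨g, by rw [← hfg]⟩ h) (by omega)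
  apply ha
  rw [← hfg, eval_mul, pow_two]
  exact mul_dvd_mul hfa hga

theorem norm_intCast_sub_eq_eval_minpoly {L : Type} [Field L] [NumberField L] (α : 𝓞 L)
    (hα : Algebra.adjoin ℚ {(α : L)} = ⊤) (a : ℤ) :
    Algebra.norm ℤ ((a : 𝓞 L) - α) = (minpoly ℤ α).eval a := by
  have hi : IsIntegral ℚ (α : L) := Algebra.IsIntegral.isIntegral _
  set B := PowerBasis.ofAdjoinEqTop hi hα with hB
  have hg : B.gen = (α : L) := by simp [hB]
  have h1 := Matrix.eval_charpoly (Algebra.leftMulMatrix B.basis B.gen) (a : ℚ)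
  rw [charpoly_leftMulMatrix, hg] at h1
  have h2 : (Matrix.scalar (Fin B.dim)) (a : ℚ) - Algebra.leftMulMatrix B.basis (α : L) =
      Algebra.leftMulMatrix B.basis ((a : L) - α) := by
    rw [map_sub]
    congr 1
    have := (Algebra.leftMulMatrix B.basis).commutes (a : ℚ)
    simp only [map_intCast] at this ⊢
  rw [h2, ← Algebra.norm_eq_matrix_det,
    minpoly.isIntegrallyClosed_eq_field_fractions' ℚ (RingOfIntegers.isIntegral_coe α),
    RingOfIntegers.minpoly_coe] at h1
  have h3 : ((Algebra.norm ℤ ((a : 𝓞 L) - α) : ℤ) : ℚ) = ((minpoly ℤ α).eval a : ℤ) := by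
    rw [Algebra.coe_norm_int]
    simp only [map_sub, map_intCast]
    rw [← h1]
    simp
  exact_mod_cast h3

theorem not_dvd_norm_one_add_mul {L : Type} [Field L] [NumberField L] (p : ℕ) [Fact p.Prime]
    (z : 𝓞 L) : ¬ (p : ℤ) ∣ Algebra.norm ℤ (1 + (p : 𝓞 L) * z) := by
  classical
  rw [← ZMod.intCast_zmod_eq_zero_iff_dvd]
  rw [Algebra.norm_eq_matrix_det (RingOfIntegers.basis L)]
  have h := RingHom.map_det (Int.castRingHom (ZMod p))
    (Algebra.leftMulMatrix (RingOfIntegers.basis L) (1 + (p : 𝓞 L) * z))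
  rw [eq_intCast] at h
  rw [h, map_add, map_mul, map_one, map_add, map_mul, map_natCast, map_one, map_natCast]
  have : ((p : ℕ) : Matrix (Module.Free.ChooseBasisIndex ℤ (𝓞 L))
      (Module.Free.ChooseBasisIndex ℤ (𝓞 L)) (ZMod p)) = 0 := by
    rw [← map_natCast (algebraMap (ZMod p) _)]
    simp
  rw [this]
  simp

theorem exists_lift_of_map_eq_zero (p : ℕ) [Fact p.Prime] (G : ℤ[X])
    (h : G.map (Int.castRingHom (ZMod p)) = 0) : ∃ Z : ℤ[X], G = (p : ℤ[X]) * Z := by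
  have : (C (p : ℤ)) ∣ G := by
    rw [C_dvd_iff_dvd_coeff]
    intro i
    have := congrArg (fun q => q.coeff i) h
    simpa [ZMod.intCast_zmod_eq_zero_iff_dvd] using this
  obtain ⟨Z, hZ⟩ := this
  exact ⟨Z, by simpa using hZ⟩

theorem exists_lift_of_map_eq (p : ℕ) [Fact p.Prime] (G H : ℤ[X])
    (h : G.map (Int.castRingHom (ZMod p)) = H.map (Int.castRingHom (ZMod p))) :
    ∃ Z : ℤ[X], G = H + (p : ℤ[X]) * Z := by
  obtain ⟨Z, hZ⟩ := exists_lift_of_map_eq_zero p (G - H) (by simp [h])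
  exact ⟨Z, by rw [← hZ]; ring⟩

theorem exists_map_eq (p : ℕ) (g : (ZMod p)[X]) :
    ∃ G : ℤ[X], G.map (Int.castRingHom (ZMod p)) = g :=
  map_surjective _ (ZMod.intCast_surjective) g

/-- `α` generates `L`, and its minimal polynomial is, modulo `p`, a product of powers of two linear
factors `X - a`, `X - b`, whose values at `a` and `b` are divisible by `p` exactly once. -/
structure TwoRootsMod {L : Type} [Field L] [NumberField L] (p : ℕ) (α : 𝓞 L) (m n : ℕ)
    (a b : ℤ) : Prop where
  adjoin_eq_top : Algebra.adjoin ℚ {(α : L)} = ⊤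
  map_minpoly : (minpoly ℤ α).map (Int.castRingHom (ZMod p)) =
    ((X - C a) ^ m * (X - C b) ^ n : ℤ[X]).map (Int.castRingHom (ZMod p))
  finrank_eq : Module.finrank ℚ L = m + n
  pos_left : 0 < m
  pos_right : 0 < n
  eval_left : ∃ A, (minpoly ℤ α).eval a = p * A ∧ ¬ (p : ℤ) ∣ A
  eval_right : ∃ A, (minpoly ℤ α).eval b = p * A ∧ ¬ (p : ℤ) ∣ A

namespace TwoRootsMod

variable {L : Type} [Field L] [NumberField L] {p : ℕ} {α : 𝓞 L} {m n : ℕ}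
  {a b : ℤ}

theorem aeval_eq [Fact p.Prime] (h : TwoRootsMod p α m n a b) :
    ∃ w : 𝓞 L, (α - a) ^ m * (α - b) ^ n = p * w := by
  obtain ⟨Z, hZ⟩ := exists_lift_of_map_eq p _ _ h.map_minpoly
  have := congrArg (aeval α) hZ
  rw [minpoly.aeval] at this
  simp only [map_add, map_mul, map_pow, map_sub, aeval_X, map_natCast, eq_intCast,
    map_intCast] at this
  exact ⟨- aeval α Z, by linear_combination -this⟩

theorem not_dvd_norm_aeval [Fact p.Prime] (h : TwoRootsMod p α m n a b) (G : ℤ[X])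
    (ha : ¬ (p : ℤ) ∣ G.eval a) (hb : ¬ (p : ℤ) ∣ G.eval b) :
    ¬ (p : ℤ) ∣ Algebra.norm ℤ (aeval α G) := by
  have key : ∀ c : ℤ, ¬ (p : ℤ) ∣ G.eval c →
      IsCoprime (X - C (c : ZMod p)) (G.map (Int.castRingHom (ZMod p))) := by
    intro c hc
    rw [(irreducible_X_sub_C _).coprime_iff_not_dvd, dvd_iff_isRoot, IsRoot.def]
    have h1 : eval ((Int.castRingHom (ZMod p)) c) (G.map (Int.castRingHom (ZMod p))) =
      (Int.castRingHom (ZMod p)) (G.eval c) := eval_map_apply _ _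
    rw [eq_intCast, eq_intCast] at h1
    rwa [h1, ZMod.intCast_zmod_eq_zero_iff_dvd]
  have hco := ((key a ha).pow_left (m := m)).mul_left ((key b hb).pow_left (m := n))
  obtain ⟨r, s, hrs⟩ := hco
  obtain ⟨R, rfl⟩ := exists_map_eq p r
  obtain ⟨S, rfl⟩ := exists_map_eq p s
  obtain ⟨Z, hZ⟩ := exists_lift_of_map_eq p (R * ((X - C a) ^ m * (X - C b) ^ n) + S * G) 1
    (by simpa using hrs)
  obtain ⟨w, hw⟩ := h.aeval_eq
  have h2 := congrArg (aeval α) hZ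
  simp only [map_add, map_mul, map_pow, map_sub, aeval_X, map_natCast, eq_intCast,
    map_intCast, map_one] at h2
  rw [hw] at h2
  intro hd
  apply not_dvd_norm_one_add_mul p (aeval α Z - aeval α R * w)
  rw [show 1 + (p : 𝓞 L) * (aeval α Z - aeval α R * w) = aeval α S * aeval α G by
    linear_combination -h2, map_mul]
  exact hd.mul_left _

theorem norm_sub_left (h : TwoRootsMod p α m n a b) :
    ∃ A, Algebra.norm ℤ ((a : 𝓞 L) - α) = p * A ∧ ¬ (p : ℤ) ∣ A := by
  rw [norm_intCast_sub_eq_eval_minpoly α h.adjoin_eq_top]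
  exact h.eval_left

theorem norm_sub_right (h : TwoRootsMod p α m n a b) :
    ∃ A, Algebra.norm ℤ ((b : 𝓞 L) - α) = p * A ∧ ¬ (p : ℤ) ∣ A := by
  rw [norm_intCast_sub_eq_eval_minpoly α h.adjoin_eq_top]
  exact h.eval_right

theorem conductor_ne_bot (h : TwoRootsMod p α m n a b) : conductor ℤ α ≠ ⊥ := by
  intro h0
  have h1 := conductor_mul_differentIdeal ℤ ℚ L α h.adjoin_eq_top
  rw [h0, Ideal.bot_mul, eq_comm, Ideal.span_singleton_eq_bot] at h1
  have h2 : IsIntegral ℚ (α : L) := Algebra.IsIntegral.isIntegral _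
  have h3 : aeval (α : L) (derivative (minpoly ℚ (α : L))) ≠ 0 :=
    (Algebra.IsSeparable.isSeparable ℚ (α : L)).aeval_derivative_ne_zero (minpoly.aeval _ _)
  apply h3
  rw [minpoly.isIntegrallyClosed_eq_field_fractions' ℚ (RingOfIntegers.isIntegral_coe α),
    RingOfIntegers.minpoly_coe, derivative_map, aeval_map_algebraMap,
    aeval_algebraMap_apply, h1, map_zero]

variable [hp : Fact p.Prime]

theorem norm_pow_mul_pow (h : TwoRootsMod p α m n a b) (i j : ℕ) :
    ∃ A, Algebra.norm ℤ (((a : 𝓞 L) - α) ^ i * ((b : 𝓞 L) - α) ^ j) = p ^ (i + j) * A ∧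
      ¬ (p : ℤ) ∣ A := by
  obtain ⟨A, hA, hA'⟩ := h.norm_sub_left
  obtain ⟨B, hB, hB'⟩ := h.norm_sub_right
  have hpp : Prime (p : ℤ) := Nat.prime_iff_prime_int.mp hp.out
  refine ⟨A ^ i * B ^ j, ?_, ?_⟩
  · rw [map_mul, map_pow, map_pow, hA, hB]
    ring
  · intro hd
    rcases hpp.dvd_or_dvd hd with hd | hd
    · exact hA' (hpp.dvd_of_dvd_pow hd)
    · exact hB' (hpp.dvd_of_dvd_pow hd)

theorem not_dvd_pow_mul_pow (h : TwoRootsMod p α m n a b) (i j : ℕ) (hij : i + j < m + n) :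
    ¬ (p : 𝓞 L) ∣ (α - a) ^ i * (α - b) ^ j := by
  rintro ⟨z, hz⟩
  obtain ⟨A, hA, hA'⟩ := h.norm_pow_mul_pow i j
  have h1 : ((a : 𝓞 L) - α) ^ i * ((b : 𝓞 L) - α) ^ j =
      (p : 𝓞 L) * ((-1) ^ (i + j) * z) := by
    rw [← neg_sub α, ← neg_sub α, neg_pow, neg_pow (α - (b : 𝓞 L)), pow_add]
    linear_combination (-1) ^ i * (-1) ^ j * hz
  rw [h1, map_mul] at hA
  have h2 : Algebra.norm ℤ (p : 𝓞 L) = (p : ℤ) ^ (m + n) := by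
    have := Algebra.norm_algebraMap (R := ℤ) (S := 𝓞 L) (p : ℤ)
    rw [RingOfIntegers.rank, h.finrank_eq] at this
    simpa using this
  rw [h2] at hA
  obtain ⟨k, hk⟩ := Nat.exists_eq_add_of_lt hij
  rw [hk] at hA
  have hp0 : (p : ℤ) ≠ 0 := by exact_mod_cast hp.out.ne_zero
  apply hA'
  refine ⟨p ^ k * Algebra.norm ℤ ((-1) ^ (i + j) * z), ?_⟩
  apply mul_left_cancel₀ (pow_ne_zero (i + j) hp0)
  rw [← hA]
  ring

theorem pow_dvd_of_aux {k : Type} [Field k] (c : k) (g q : k[X]) (m : ℕ)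
    (h : ¬ (X - C c) ^ m ∣ g) :
    ∃ s t : k[X], (X - C c) ^ (m - 1) * q = s * (g * q) + t * ((X - C c) ^ m * q) := by
  classical
  have hg : g ≠ 0 := by rintro rfl; exact h (dvd_zero _)
  obtain ⟨r, hr, hr'⟩ := exists_eq_pow_rootMultiplicity_mul_and_not_dvd g hg c
  set i := rootMultiplicity c g
  have hi : i < m := by
    by_contra hi
    push Not at hi
    exact h (hr ▸ (pow_dvd_pow _ hi).mul_right _)
  obtain ⟨u, v, huv⟩ := (irreducible_X_sub_C c).coprime_iff_not_dvd.mpr hr'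
  refine ⟨v * (X - C c) ^ (m - 1 - i), u, ?_⟩
  obtain ⟨l, rfl⟩ := Nat.exists_eq_add_of_lt hi
  rw [hr]
  have e1 : i + l + 1 - 1 = i + l := by omega
  have e2 : i + l - i = l := by omega
  rw [e1, e2]
  linear_combination (-(X - C c) ^ (i + l) * q) * huv

theorem pow_dvd_map (h : TwoRootsMod p α m n a b) (hab : ¬ (p : ℤ) ∣ a - b) (G : ℤ[X]) (z : 𝓞 L)
    (hz : aeval α G = p * z) :
    (minpoly ℤ α).map (Int.castRingHom (ZMod p)) ∣ G.map (Int.castRingHom (ZMod p)) := by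
  have aux : ∀ (c d : ℤ) (k l : ℕ) (w : 𝓞 L), (α - c) ^ k * (α - d) ^ l = p * w →
      ¬ (p : 𝓞 L) ∣ (α - c) ^ (k - 1) * (α - d) ^ l →
      (X - C (c : ZMod p)) ^ k ∣ G.map (Int.castRingHom (ZMod p)) := by
    intro c d k l w hw hnd
    by_contra hc
    obtain ⟨s, t, hst⟩ := pow_dvd_of_aux (c : ZMod p) _ ((X - C (d : ZMod p)) ^ l) k hc
    obtain ⟨S, rfl⟩ := exists_map_eq p s
    obtain ⟨T, rfl⟩ := exists_map_eq p t
    obtain ⟨Z, hZ⟩ := exists_lift_of_map_eq p ((X - C c) ^ (k - 1) * (X - C d) ^ l)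
      (S * (G * (X - C d) ^ l) + T * ((X - C c) ^ k * (X - C d) ^ l)) (by simpa using hst)
    have h2 := congrArg (aeval α) hZ
    simp only [map_add, map_mul, map_pow, map_sub, aeval_X, map_natCast, eq_intCast,
      map_intCast] at h2
    rw [hw, hz] at h2
    apply hnd
    exact ⟨aeval α S * z * (α - d) ^ l + aeval α T * w + aeval α Z, by rw [h2]; ring⟩
  obtain ⟨w, hw⟩ := h.aeval_eq
  have hm := h.pos_left
  have hn := h.pos_right
  have hmap : ((X - C a) ^ m * (X - C b) ^ n : ℤ[X]).map (Int.castRingHom (ZMod p)) =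
      (X - C (a : ZMod p)) ^ m * (X - C (b : ZMod p)) ^ n := by simp
  rw [h.map_minpoly, hmap]
  refine IsCoprime.mul_dvd ?_ ?_ ?_
  · apply IsCoprime.pow
    apply isCoprime_X_sub_C_of_isUnit_sub
    rw [isUnit_iff_ne_zero, ← Int.cast_sub, Ne, ZMod.intCast_zmod_eq_zero_iff_dvd]
    exact hab
  · exact aux a b m n w hw (h.not_dvd_pow_mul_pow _ _ (by omega))
  · refine aux b a n m w (by rw [← hw]; ring) ?_
    rw [mul_comm]
    exact h.not_dvd_pow_mul_pow _ _ (by omega)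

theorem mem_adjoin_of_mul_mem (h : TwoRootsMod p α m n a b) (hab : ¬ (p : ℤ) ∣ a - b) (z : 𝓞 L)
    (hz : (p : 𝓞 L) * z ∈ Algebra.adjoin ℤ {α}) : z ∈ Algebra.adjoin ℤ {α} := by
  rw [Algebra.adjoin_singleton_eq_range_aeval, AlgHom.mem_range] at hz ⊢
  obtain ⟨G, hG⟩ := hz
  obtain ⟨q, hq⟩ := h.pow_dvd_map hab G z hG
  obtain ⟨Q, rfl⟩ := exists_map_eq p q
  obtain ⟨Z, hZ⟩ := exists_lift_of_map_eq p G (minpoly ℤ α * Q) (by simpa using hq)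
  refine ⟨Z, ?_⟩
  rw [hZ] at hG
  simp only [map_add, map_mul, minpoly.aeval, zero_mul, zero_add, map_natCast] at hG
  exact mul_left_cancel₀ (by exact_mod_cast hp.out.ne_zero) hG

theorem not_dvd_absNorm_conductor (h : TwoRootsMod p α m n a b) (hab : ¬ (p : ℤ) ∣ a - b) :
    ¬ p ∣ Ideal.absNorm (conductor ℤ α) := by
  have hN0 : Ideal.absNorm (conductor ℤ α) ≠ 0 := by
    rw [Ne, Ideal.absNorm_eq_zero_iff]
    exact h.conductor_ne_bot
  have hN := Ideal.absNorm_mem (conductor ℤ α)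
  have hdesc : ∀ (k c : ℕ), ((p ^ k * c : ℕ) : 𝓞 L) ∈ conductor ℤ α →
      (c : 𝓞 L) ∈ conductor ℤ α := by
    intro k c
    induction k with
    | zero => simp
    | succ k ih =>
      intro hk
      apply ih
      rw [mem_conductor_iff] at hk ⊢
      intro y
      apply h.mem_adjoin_of_mul_mem hab
      convert hk y using 1
      push_cast
      ring
  obtain ⟨k, c, hc, hkc⟩ := Nat.exists_eq_pow_mul_and_not_dvd hN0 p hp.out.ne_one
  rw [hkc] at hN
  have hc' := hdesc k c hN
  intro hd
  have h1 : Ideal.absNorm (conductor ℤ α) ∣ Ideal.absNorm (Ideal.span {(c : 𝓞 L)}) :=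
    Ideal.absNorm_dvd_absNorm_of_le ((Ideal.span_singleton_le_iff_mem _).mpr hc')
  rw [Ideal.absNorm_span_natCast] at h1
  exact hc (hp.out.dvd_of_dvd_pow (hd.trans h1))

/-- The `p`-part of the discriminant is the `p`-part of the norm of `P'(α)`. -/
theorem exists_norm_derivative_eq (h : TwoRootsMod p α m n a b) (hab : ¬ (p : ℤ) ∣ a - b) :
    ∃ c : ℕ, ¬ p ∣ c ∧
      (Algebra.norm ℤ (aeval α (derivative (minpoly ℤ α)))).natAbs = c * (discr L).natAbs := by
  refine ⟨_, h.not_dvd_absNorm_conductor hab, ?_⟩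
  rw [← Ideal.absNorm_span_singleton, ← conductor_mul_differentIdeal ℤ ℚ L α h.adjoin_eq_top,
    map_mul, absNorm_differentIdeal L]

end TwoRootsMod

/-- `v` is the value at `a` of the rational polynomial with numerator list `q.1` and
denominator `q.2`. -/
def Represents {R : Type} [CommRing R] (a v : R) (q : List ℤ × ℤ) : Prop :=
  (q.2 : R) * v = evalList a q.1

/-- Sum of two fractions. -/
def fracAdd (p q : List ℤ × ℤ) : List ℤ × ℤ :=
  (addList (smulList q.2 p.1) (smulList p.2 q.1), p.2 * q.2)

/-- Product of two fractions modulo the monic polynomial with lower coefficients `t`. -/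
def fracMul (t : List ℤ) (p q : List ℤ × ℤ) : List ℤ × ℤ :=
  (mulMod t p.1 q.1, p.2 * q.2)

/-- Value of an integer polynomial at a fraction. -/
def fracEval (t : List ℤ) (q : List ℤ × ℤ) : List ℤ → List ℤ × ℤ
  | [] => ([], 1)
  | c :: l => fracAdd ([c], 1) (fracMul t q (fracEval t q l))

namespace Represents

variable {R : Type} [CommRing R] {a v w : R} {p q : List ℤ × ℤ} {t : List ℤ}

theorem int (a : R) (c : ℤ) : Represents a (c : R) ([c], 1) := by
  simp [Represents, evalList]

theorem add (hp : Represents a v p) (hq : Represents a w q) :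
    Represents a (v + w) (fracAdd p q) := by
  simp only [Represents, fracAdd, evalList_addList, evalList_smulList] at *
  rw [← hp, ← hq]; push_cast; ring

theorem mul (ht : t ≠ []) (ha : evalList a (t ++ [1]) = 0) (hp : Represents a v p)
    (hq : Represents a w q) : Represents a (v * w) (fracMul t p q) := by
  simp only [Represents, fracMul, evalList_mulMod ht ha] at *
  rw [← hp, ← hq]; push_cast; ring

theorem eval (ht : t ≠ []) (ha : evalList a (t ++ [1]) = 0) (hp : Represents a v p) (l : List ℤ) :
    Represents a (evalList v l) (fracEval t p l) := by
  induction l with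
  | nil => simp [Represents, fracEval, evalList]
  | cons c l ih => exact (int a c).add (hp.mul ht ha ih)

theorem of_div {M : Type} [Field M] [CharZero M] (a : M) (l : List ℤ) {d : ℤ} (hd : d ≠ 0) :
    Represents a (evalList a l / d) (l, d) := by
  have : (d : M) ≠ 0 := by exact_mod_cast hd
  simp only [Represents]
  field_simp

theorem eq_zero {M : Type} [Field M] [CharZero M] {a v : M} {q : List ℤ × ℤ}
    (h : Represents a v q) (hd : q.2 ≠ 0) (hq : q.1.all (· == 0) = true) : v = 0 := by
  have h2 : (q.2 : M) ≠ 0 := by exact_mod_cast hd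
  rw [Represents, evalList_eq_zero_of_all a hq] at h
  exact (mul_eq_zero.mp h).resolve_left h2

end Represents

/-- `f_D` as a function of `c = 2⁸·3¹³·τ`, of the square root `u` of `-11`, and of `x`. -/
def fVal {R : Type} [CommRing R] (c u x : R) : R :=
  -121 * u * (1188 * u * x ^ 3 + 198 * u * x ^ 2 - 1346 * u * x - 27 * u
    + 594 * x ^ 4 - 7920 * x ^ 2 - 1474 * x + 135) ^ 3 - c * (253 * u - 67) * x

/-- The rational part of `f_D`. -/
def fRat {R : Type} [CommRing R] (c x : R) : R :=
  1331 * (3 * (594 * x ^ 4 - 7920 * x ^ 2 - 1474 * x + 135) ^ 2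
    * (1188 * x ^ 3 + 198 * x ^ 2 - 1346 * x - 27)
    - 11 * (1188 * x ^ 3 + 198 * x ^ 2 - 1346 * x - 27) ^ 3) + 67 * c * x

/-- The coefficient of `√-11` in `f_D`. -/
def fIrr {R : Type} [CommRing R] (c x : R) : R :=
  -121 * ((594 * x ^ 4 - 7920 * x ^ 2 - 1474 * x + 135) ^ 3
    - 33 * (594 * x ^ 4 - 7920 * x ^ 2 - 1474 * x + 135)
    * (1188 * x ^ 3 + 198 * x ^ 2 - 1346 * x - 27) ^ 2) - 253 * c * x

section fVal

variable {R S : Type} [CommRing R] [CommRing S]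

theorem fVal_eq {u : R} (hu : u ^ 2 = -11) (c x : R) : fVal c u x = fRat c x + u * fIrr c x := by
  unfold fVal fRat fIrr
  generalize hp : 594 * x ^ 4 - 7920 * x ^ 2 - 1474 * x + 135 = p
  generalize hq : 1188 * x ^ 3 + 198 * x ^ 2 - 1346 * x - 27 = q
  have : 1188 * u * x ^ 3 + 198 * u * x ^ 2 - 1346 * u * x - 27 * u
      + 594 * x ^ 4 - 7920 * x ^ 2 - 1474 * x + 135 = p + u * q := by rw [← hp, ← hq]; ring
  rw [this]
  linear_combination (-121) * (3 * p ^ 2 * q + 3 * p * q ^ 2 * u + q ^ 3 * (u ^ 2 - 11)) * hu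

theorem fVal_mul_fVal_neg {u : R} (hu : u ^ 2 = -11) (c x : R) :
    fVal c u x * fVal c (-u) x = fRat c x ^ 2 + 11 * fIrr c x ^ 2 := by
  rw [fVal_eq hu, fVal_eq (u := -u) (by rw [neg_sq, hu])]
  linear_combination (- fIrr c x ^ 2) * hu

theorem map_fRat (f : R →+* S) (c x : R) : f (fRat c x) = fRat (f c) (f x) := by
  simp only [fRat, map_add, map_sub, map_mul, map_pow, map_ofNat]

theorem map_fIrr (f : R →+* S) (c x : R) : f (fIrr c x) = fIrr (f c) (f x) := by
  simp only [fIrr, map_add, map_sub, map_mul, map_pow, map_neg, map_ofNat]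

end fVal

theorem natDegree_fRat_sq_add_fIrr_sq (c : ℚ) :
    (fRat (C c) X ^ 2 + 11 * fIrr (C c) X ^ 2 : ℚ[X]).natDegree = 24 := by
  unfold fRat fIrr
  compute_degree!

theorem minpoly_eq_and_adjoin_eq_top {L : Type} [Field L] [NumberField L] {α : 𝓞 L} {t : List ℤ}
    (hirr : Irreducible (evalList (X : ℤ[X]) (t ++ [1]))) (hα : evalList α (t ++ [1]) = 0)
    (hrank : Module.finrank ℚ L = t.length) :
    minpoly ℤ α = evalList X (t ++ [1]) ∧ Algebra.adjoin ℚ {(α : L)} = ⊤ := by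
  have hint : IsIntegral ℤ α := RingOfIntegers.isIntegral α
  have h1 : minpoly ℤ α = evalList X (t ++ [1]) := by
    have hd : minpoly ℤ α ∣ evalList X (t ++ [1]) :=
      minpoly.isIntegrallyClosed_dvd hint (by rw [aeval_evalList, hα])
    exact eq_of_monic_of_associated (minpoly.monic hint) (monic_evalList_append_one t)
      ((hirr.dvd_iff.mp hd).resolve_left (minpoly.not_isUnit ℤ α)).symm
  refine ⟨h1, ?_⟩
  have h2 : (minpoly ℚ (α : L)).natDegree = Module.finrank ℚ L := by
    rw [minpoly.isIntegrallyClosed_eq_field_fractions' ℚ (RingOfIntegers.isIntegral_coe α),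
      RingOfIntegers.minpoly_coe, (minpoly.monic hint).natDegree_map, h1,
      natDegree_evalList_append_one, hrank]
  have h3 := (Field.primitive_element_iff_minpoly_natDegree_eq ℚ (α : L)).mpr h2
  have h4 := IntermediateField.adjoin_simple_toSubalgebra_of_isAlgebraic
    (Algebra.IsAlgebraic.isAlgebraic (R := ℚ) (α : L))
  rw [← h4, h3, IntermediateField.top_toSubalgebra]

/-- Lower coefficients of a polynomial `P` defining the number field `ℚ(α)`. -/
def tailA : List ℤ :=
    [17275, -125324, 395323, -670714, 547844, 100287, -719433, 637725, 59268, -633347, 585486,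
     -118005, -243380, 250748, -74503, -37378, 38423, -10021, -1133, 913, -22, -22, -10, 2]

/-- Lower coefficients of the minimal polynomial of another integral generator `β`. -/
def tailB : List ℤ :=
    [5016355, 33996791, 96883869, 135338302, 75968750, -21022496, -41513241, -10645448, -5991700,
     -14554617, -7024985, 2023798, 2179377, 489200, 334334, 315414, 88341, -6644, -3234, 1023, 451,
     -22, -17, 3]

/-- Numerator, in terms of `α`, of the root of `h`. -/
def xNum : List ℤ :=
    [-749903313184194117914476411250984976168360790285257533456645,
     4973488775850998190637438918272464409619531784949348397334647,
     -13907022111711168070480530080995646254224224898459825062073921,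
     19635038557297616352564588905739076892408828785027156005058998,
     -9803800418964852443026206441415347125492704343884665370010660,
     -12080672344801714886470583294375269755163402566222238597391216,
     23444912982316098524302953219654796678590982855603908144772825,
     -10920955067213070160890214280721392569997143247272612375269815,
     -11203038900940081811729992502176751145007429051871652897062164,
     20193820851812217062333239449772570615567918265935126131511005,
     -10951398837859355899739721536681134955229549693722512286952728,
     -3235375193168400038759803027316506603867191131848880026795972,
     8651094792320884708608909002646392049509029010011554166049147,
     -4676047914817471762220600440312642035790785612620670064730336,
     -318238099356981260327961378128773764946823607332531559472485,
     1491276103878359633859097145783220073674607286667196214622394,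
     -578198488163837257757528119965259723427877514928951218453878,
     -7719660980257186506010233756447685685276592083272065662904,
     47950614697672945620134721880401898799616863151919843269468,
     -3174566208146943876018402781208715681812979680064512174682,
     -1683622271868571509543607897721000933943894655015863017937,
     -362663692937351746359298426556572050064680022204692520242,
     178085002242700568124400917702038944674006751532934628282,
     56348379419767557427500898582679220098907807435672795647]

/-- Denominator of the root of `h`. -/
def xDen : ℤ :=
  615766662837938656766393069557153087179616372268094741270

/-- Numerator, in terms of `α`, of `(1 + √-11) / 2`. -/
def wNum : List ℤ :=
    [-162555327330509046498972502957680363177, 994514123782414596440213935051092838303,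
     -2592511987703297986529087504683733531356, 3380882607446172770486487133897231353201,
     -1346792089738146870396026334323915611134, -2444222881492882561688449197216180242045,
     3999240839061776058229338855914054068823, -1497972201351787820765107034707895250986,
     -2226986624599573993264366550015620048845, 3437109975878015304835463965711797400285,
     -1639482350641282983215108690234677888319, -724945500884512157501593972969225354343,
     1465854923613037606664823279433482722680, -709403435422511657298171260003915902695,
     -93735728174664317008873151194507365573, 244401107536291473669433694830533649421,
     -86798396613364566051494618045225795097, -2916558010276674009339539285662269733,
     7306156492662562114280575767549746573, -402928297667993103654488345085656361,
     -240607500138252154908982981089643124, -61877759497538555464341334723474781,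
     24413323803895791953536020168520364, 8404302500540713978419209971244376]

/-- Denominator of `(1 + √-11) / 2`. -/
def wDen : ℤ :=
  99751922608214013729143767285104022

/-- Numerator, in terms of `α`, of the second integral generator `β`. -/
def bNum : List ℤ :=
    [-131160757177547976229789912195407471654950301893900492053685,
     812565999868124089321327372146328302870132664218421659161186,
     -2137161219118353301540010265996467486041789579633869721098983,
     2808424681303747216069550341436594194275592002550939951836109,
     -1137871935919859685618119697429187630994410938857303598324625,
     -2015791776614593525408017039376979274565538487844697384595943,
     3327462438124977409475939793950697938030759949643494661684180,
     -1259301192811660282828717785102452015428384979639228116929375,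
     -1840946044498361380148756611531387938777633853805876701312057,
     2856574247466246671184934268293786023253601396898102748382590,
     -1367725056507298020699436455031572652228048572100297491982724,
     -600137789459320927962084753741930209875710542810674194725476,
     1219339370897254329065109024969173830722042985023510908936021,
     -589685701032173038495091753823020385631539480158892946615153,
     -78998559194997610643158057934047080119058862592387178100520,
     203265012687985613267953276330793991809192490164593721498992,
     -71733759554816300489671690666662377892934927306831489461714,
     -2578299404512484901178055787432448692682126881449460430512,
     6039971030858089460678769994188025343076997162578016722684,
     -322324862682449785088184865382189781947681187813526311256,
     -198599902454741093494203651675007200528044247094921178131,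
     -52339669272451136955365654118517517346661371600682211621,
     19784564537233826198984172790716952501669597780953112581,
     6907761845333956646867329774747648635371778880030129816]

/-- Denominator of `β`. -/
def bDen : ℤ :=
  18659595843573898689890699077489487490291405220245295190

/-- Expression of `α` in terms of `x` and `(1 + √-11) / 2`: the part free of the latter. -/
def alphaEven : List ℤ :=
    [81065131763, 6873999889218, -34084407101943, -498294825839283, -203420508238431,
     1339500456996636, 608274509669706, -482179940750904, -142915312785201, 30244990311294,
     3938382060954, -180146494968]

/-- Expression of `α` in terms of `x` and `(1 + √-11) / 2`: the coefficient of the latter. -/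
def alphaOdd : List ℤ :=
    [-52486542763, -3892380252266, -51669609671834, 97805370985399, 640528612181502, 76192779264173,
     -654963237379990, -130225040548372, 107552003160371, 12633378672442, -2593967448347,
     -83585791102]

/-- Multiple of the inverse of `P'(α)`. -/
def invDerivA : List ℤ :=
    [
     1132726613283434911309220484114579394216095866395958439003793562548125095285996144645110159825220894914675825786750,
     -7119933872907301847165077035899585151273406405203700486607359331140652932288465951655151524920425619765130968990237,
     19032952098296818919950351450242808428258129677397016505056362710928032122860594159812954549187305624218536736654771,
     -25588196859258381876717511528015362934190794215191069212675115104870188943164739172432642198432065111058215944722008,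
     11230018891390570761849691535491452022360583150964610596918202556028105086340646024601693870303401863974970593353370,
     17376612731050635396685855005076938163943683005105733179047911057186374918856194635018845972179157301487269960677086,
     -30371168359745388942102524815832506190888948755888949325959027012865194966840429011085904913388033965755091776779095,
     12515253812680142661343845281189469159449362046357883151409066398152663863056050080544050037706162542541196269877195,
     15927003135873899010085798286709518221264295127994649879066169901388155240843719495080036158244800205795290504106564,
     -26134210707958379769979224935471004500482190576525272164269645012695491285966211882998813997306526575072511450431620,
     13176024921513006946984795769065937121031905928871404642617577810887766212331071471527088583288668805946160502148163,
     4956283418860853504807384111234966725271116989628251675223946087669895731488715832778731658123559769990511041753307,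
     -11163580319202724416857724283770650654324540095658922994430749793984099330061901796276138916579508370176323806123607,
     5672339449625234529577255463424503211893812865405770569527113358546015714278237518839199257469364310688005494840041,
     581678765692637514747141162272469408927880358907797182955483572455708654986598420926348934027896679862638692462715,
     -1888066286334577509981345450699593357867388678823356470155080898090241507480940933021772392372202321198805079468354,
     698605901414374283999060092974161243877427214963132395937280433730264503485032737748800270366010159046446420224323,
     16506420558787801584797164263306769028317429317930145601492413398150124123655111082219493806011116305592194264514,
     -58404885491367534293283815168164896533178679314023661679259958477802153052083108283578471372264267107027925645388,
     3546188755159487436651759578811419712434904316474605109638930831129767331549700580271661058031364452247342468147,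
     1981116671084853327217597176710893963104946715519523963366104407133820159639309703701031799689808052228061527757,
     466776130905298157674116104328655663661423706079423640070327262524405566933269854384659966218933610177800804972,
     -206287574711362675624723437810572109102777254642612203083081476220891704828522193246413051079303767413704442462,
     -67971199225303899185098304148536671226243175800487468227257967104042190315679296931819914105247985318921290002]

/-- Prime-to-`11` part of a multiple of `P'(α)`. -/
def tameA : ℤ :=
  174090258522760157932852314483815906043803406411598059271923826430240361309198764858055277598836976665118568050

/-- Inverse modulo `tameA` of the derivative of the minimal polynomial of `β` at `β`. -/
def invDerivB : List ℤ :=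
    [
     -8566577817540306864065389535776731260225048017560626411836450260411192779171107044625816834321109535540156644,
     10684808142811970199480417816544868385990450278264447162809646460989459211391250771616429071460269513290299961,
     -8283683452563720748698662393700821323895204802566535194116118404006998625549574037884414201122771345652211299,
     -13753449444064927120240901414131595163381949241023283668914868313861841342088334621756983642966067355965251864,
     61455692063519106902598689255803168357550494432872678040641859318043992399138513555869118344491162298809403889,
     -14935485419040002026748150033684070106958692393523837991063704996087550154288284486205577132710612311448280647,
     -2302628687699910237507537322203545210474578372880639771991863957128630273516150198374681296763717939273751677,
     -2165970333193659666780162839409241762854038441844472300768885920270147021721128245778702903075744878411411745,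
     -83826499522830932957759474687177067626800119687259608247411444732327048469263240451621693209001763352907398209,
     25788091475114761272466837735189771687360740105951191407220184527394547064639077839743885176260422136267115616,
     55483622168145744748940471037408549726363147584006293376421111821637347918150719434140919080770909513311135460,
     -64688197813460983679431727675970428081916541852309593851827144064750780074896154992270994928559832823272336083,
     -18129913069388227389215284392501496401523750818918921712408397469066551020328665390258306932936577830397249353,
     63158849028375231577221380619450071039226958222382159250627656751943809741136471947144465249094988311036394929,
     -25493880257508687660121500807156499612912687924107093774123755685212657532695584752535860993541238459954319644,
     -65458780419045120582857757821991974245286013051975560015228693523709067218687560406645992430454026568227770921,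
     -39878564381077347557722472495013505470083976972491361428425931417505943456527760157801047716864699178791177353,
     17019116817952516354587253943928092012522740082255304860857859238130175695275980588493875844944925986022825977,
     75596483832153692926471544997548702068268956622042096844577306894658644876752891215858046342429125303629562282,
     76993857701246449513611353265711180021018046182106249608926457395384366217338448376752279509539980795132663015,
     -69747761730715291471146368981621425146407628371710035470018380008308934582980175841701936057267104221296367802,
     58449044807802246006785067750843666106069724304784127719383681564875301042909633665059152268013064696866731879,
     75605447091125705380546488424913847417987157383209896496355639422941528803542916363766261581957484795635736493,
     61009218528502923160720273518801445386752127834958311050114107859221695418480370153238026334552355209269467372]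

/-- Common denominator in the expression of `α`. -/
def alphaDen : ℤ :=
  138528872045

theorem tailA_ne_nil : tailA ≠ [] := by decide

/-- The fraction representing `x`. -/
def xFrac : List ℤ × ℤ := (xNum, xDen)

/-- The fraction representing `(1 + √-11) / 2`. -/
def wFrac : List ℤ × ℤ := (wNum, wDen)

/-- The fraction representing `√-11` times `s = ±1`. -/
def uFrac (s : ℤ) : List ℤ × ℤ :=
  fracAdd (fracMul tailA ([2 * s], 1) wFrac) ([-s], 1)

/-- The fraction representing `99 f_D`, for the square root `q` of `-11`. -/
def fFrac (q : List ℤ × ℤ) : List ℤ × ℤ :=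
  let g := fracAdd (fracEval tailA xFrac [135, -1474, -7920, 0, 594])
    (fracMul tailA q (fracEval tailA xFrac [-27, -1346, 198, 1188]))
  fracAdd
    (fracMul tailA (fracMul tailA ([-11979], 1) q) (fracMul tailA g (fracMul tailA g g)))
    (fracMul tailA (fracMul tailA ([-4 * 2087 ^ 3], 1)
      (fracAdd (fracMul tailA ([253], 1) q) ([-67], 1))) xFrac)

theorem represents_fFrac {M : Type} [Field M] [CharZero M] {a x u : M} {q : List ℤ × ℤ}
    (ha : evalList a (tailA ++ [1]) = 0) (hx : Represents a x xFrac) (hu : Represents a u q) :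
    Represents a (99 * fVal (4 * 2087 ^ 3 / 99) u x) (fFrac q) := by
  have hg := (hx.eval tailA_ne_nil ha [135, -1474, -7920, 0, 594]).add
    (hu.mul tailA_ne_nil ha (hx.eval tailA_ne_nil ha [-27, -1346, 198, 1188]))
  have h := (((Represents.int a (-11979)).mul tailA_ne_nil ha hu).mul tailA_ne_nil ha
    (hg.mul tailA_ne_nil ha (hg.mul tailA_ne_nil ha hg))).add
    ((((Represents.int a (-4 * 2087 ^ 3)).mul tailA_ne_nil ha
      (((Represents.int a 253).mul tailA_ne_nil ha hu).add (Represents.int a (-67)))).mul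
        tailA_ne_nil ha hx))
  refine Eq.trans ?_ h
  congr 1
  simp only [evalList, fVal]
  push_cast
  field_simp
  ring

/-- A root `x` of `f_D` and a square root of `-11` in any field containing a root of `P`. -/
theorem exists_root {M : Type} [Field M] [CharZero M] {a : M}
    (ha : evalList a (tailA ++ [1]) = 0) :
    ∃ x u : M, u ^ 2 = -11 ∧ fVal (4 * 2087 ^ 3 / 99) u x = 0 ∧
      (∃ l : List ℤ, l.length ≤ 24 ∧ l.any (· != 0) = true ∧
        (evalList a l ≠ 0 → fVal (4 * 2087 ^ 3 / 99) (-u) x ≠ 0)) ∧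
      alphaDen * a = evalList x alphaEven + (1 + u) / 2 * evalList x alphaOdd := by
  have hx : Represents a _ xFrac := Represents.of_div a xNum (d := xDen) (by decide)
  have hw : Represents a _ wFrac := Represents.of_div a wNum (d := wDen) (by decide)
  set x := evalList a xNum / xDen
  set w := evalList a wNum / wDen
  have hu : ∀ s : ℤ, Represents a ((2 * s : ℤ) * w + (-s : ℤ)) (uFrac s) := fun s =>
    ((Represents.int a (2 * s)).mul tailA_ne_nil ha hw).add (Represents.int a (-s))
  refine ⟨x, (2 * 1 : ℤ) * w + (-1 : ℤ), ?_, ?_, ⟨(fFrac (uFrac (-1))).1, ?_, ?_, ?_⟩, ?_⟩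
  · have := (((hu 1).mul tailA_ne_nil ha (hu 1)).add (Represents.int a 11)).eq_zero
      (by decide +kernel) (by decide +kernel)
    push_cast at this ⊢
    linear_combination this
  · have := (represents_fFrac ha hx (hu 1)).eq_zero (by decide +kernel) (by decide +kernel)
    exact (mul_eq_zero.mp this).resolve_left (by norm_num)
  · decide +kernel
  · decide +kernel
  · intro h h0
    have h1 := represents_fFrac ha hx (hu (-1))
    have e : (((2 * -1 : ℤ) : M) * w + ((- -1 : ℤ) : M)) = -((2 * 1 : ℤ) * w + (-1 : ℤ)) := by
      push_cast; ring
    rw [e, h0, Represents, mul_zero, mul_zero] at h1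
    exact h h1.symm
  · have he := hx.eval tailA_ne_nil ha alphaEven
    have ho := hx.eval tailA_ne_nil ha alphaOdd
    have hr : Represents a a ([0, 1], 1) := by simp [Represents, evalList]
    have := ((he.add (hw.mul tailA_ne_nil ha ho)).add
      ((Represents.int a (-alphaDen)).mul tailA_ne_nil ha hr)).eq_zero
      (by decide +kernel) (by decide +kernel)
    push_cast at this ⊢
    linear_combination -this

/-- Irreducibility of an integer polynomial that is, modulo `11`, a product of powers of two
linear factors, and has no monic factor of degree at most two modulo `17`. -/
theorem irreducible_evalList_of_mod {t : List ℤ} {a b : ℤ} {m n : ℕ}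
    (hmn : n < m) (hn : n ≤ 2) (ht : t.length = m + n)
    (hmap : (evalList (X : ℤ[X]) (t ++ [1])).map (Int.castRingHom (ZMod 11)) =
      ((X - C a) ^ m * (X - C b) ^ n : ℤ[X]).map (Int.castRingHom (ZMod 11)))
    (ha : ¬ (11 : ℤ) ^ 2 ∣ evalList a (t ++ [1]))
    (h1 : ∀ r : ZMod 17, evalList r (t ++ [1]) ≠ 0)
    (h2 : ∀ q s : ZMod 17, pairEval q s (t ++ [1]) ≠ (0, 0)) :
    Irreducible (evalList (X : ℤ[X]) (t ++ [1])) := by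
  have : Fact (Nat.Prime 11) := ⟨by norm_num⟩
  have : Fact (Nat.Prime 17) := ⟨by norm_num⟩
  refine irreducible_of_map_eq_pow_mul_pow 11 (monic_evalList_append_one t) (m := m) (n := n)
    (a := a) (b := b) (by omega) (by rw [natDegree_evalList_append_one, ht]) hmap ?_ ?_
  · rw [eval_evalList]; exact_mod_cast ha
  · intro g hg hd hpos
    have e1 := natDegree_ne_one_of_dvd 17 h1 hg hd
    have e2 := natDegree_ne_two_of_dvd 17 h2 hg hd
    omega

theorem map_evalList_eq_of_all {l l' : List ℤ} {p : ℕ}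
    (h : (addList l (smulList (-1) l')).all ((p : ℤ) ∣ ·) = true) :
    (evalList (X : ℤ[X]) l).map (Int.castRingHom (ZMod p)) =
      (evalList (X : ℤ[X]) l').map (Int.castRingHom (ZMod p)) := by
  have := congrArg (Polynomial.map (Int.castRingHom (ZMod p))) (evalList_smul_div (X : ℤ[X]) p h)
  rw [evalList_addList, evalList_smulList] at this
  simp only [Polynomial.map_add, Polynomial.map_mul, Int.cast_natCast,
    Polynomial.map_natCast, CharP.cast_eq_zero, zero_mul, Int.cast_neg, Int.cast_one] at this
  rw [← sub_eq_zero, ← this]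
  simp
  ring

theorem evalList_iterate_mulList (l : List ℤ) (n : ℕ) (m : List ℤ) {R : Type} [CommRing R]
    (a : R) : evalList a ((mulList l)^[n] m) = evalList a l ^ n * evalList a m := by
  induction n with
  | zero => simp
  | succ n ih => rw [Function.iterate_succ_apply', evalList_mulList, ih]; ring

theorem map_evalList_eq_pow_mul_pow {t : List ℤ} {a b : ℤ} {m n : ℕ}
    (h : (addList (t ++ [1]) (smulList (-1)
      ((mulList [-a, 1])^[m] ((mulList [-b, 1])^[n] [1])))).all (11 ∣ ·) = true) :
    (evalList (X : ℤ[X]) (t ++ [1])).map (Int.castRingHom (ZMod 11)) =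
      ((X - C a) ^ m * (X - C b) ^ n : ℤ[X]).map (Int.castRingHom (ZMod 11)) := by
  rw [map_evalList_eq_of_all h, evalList_iterate_mulList, evalList_iterate_mulList]
  simp [evalList, neg_add_eq_sub]

theorem map_evalList_tailA : (evalList (X : ℤ[X]) (tailA ++ [1])).map (Int.castRingHom (ZMod 11)) =
    ((X - C 4) ^ 22 * (X - C 10) ^ 2 : ℤ[X]).map (Int.castRingHom (ZMod 11)) :=
  map_evalList_eq_pow_mul_pow (by decide +kernel)

theorem irreducible_tailA : Irreducible (evalList (X : ℤ[X]) (tailA ++ [1])) :=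
  irreducible_evalList_of_mod (m := 22) (n := 2) (by norm_num) le_rfl rfl map_evalList_tailA
    (by decide +kernel) (by decide +kernel) (by decide +kernel)

theorem irreducible_tailB : Irreducible (evalList (X : ℤ[X]) (tailB ++ [1])) :=
  irreducible_evalList_of_mod (a := 7) (b := 4) (m := 22) (n := 2) (by norm_num) le_rfl rfl
    (map_evalList_eq_pow_mul_pow (by decide +kernel))
    (by decide +kernel) (by decide +kernel) (by decide +kernel)

/-- A nonzero polynomial of smaller degree does not vanish at a root of an irreducible one. -/
theorem evalList_ne_zero_of_irreducible {M : Type} [Field M] [CharZero M] {a : M} {t : List ℤ}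
    (ht : Irreducible (evalList (X : ℤ[X]) (t ++ [1]))) (ha : evalList a (t ++ [1]) = 0)
    {l : List ℤ} (hl : l.length ≤ t.length) (hl' : l.any (· != 0) = true) :
    evalList a l ≠ 0 := by
  intro h0
  have hint : IsIntegral ℤ a := ⟨_, monic_evalList_append_one t, by
    rw [← aeval_def, aeval_evalList, ha]⟩
  have h1 : minpoly ℤ a = evalList X (t ++ [1]) :=
    eq_of_monic_of_associated (minpoly.monic hint) (monic_evalList_append_one t)
      ((ht.dvd_iff.mp (minpoly.isIntegrallyClosed_dvd hint
        (by rw [aeval_evalList, ha]))).resolve_left (minpoly.not_isUnit ℤ a)).symm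
  have h2 : minpoly ℤ a ∣ evalList X l :=
    minpoly.isIntegrallyClosed_dvd hint (by rw [aeval_evalList, h0])
  have h3 : evalList (X : ℤ[X]) l = 0 := by
    apply eq_zero_of_dvd_of_degree_lt h2
    refine (degree_evalList_lt l).trans_le ?_
    rw [h1, degree_eq_natDegree (monic_evalList_append_one t).ne_zero,
      natDegree_evalList_append_one]
    exact_mod_cast hl
  obtain ⟨c, hc, hc'⟩ := List.any_eq_true.mp hl'
  obtain ⟨i, hi, rfl⟩ := List.mem_iff_getElem.mp hc
  have h4 := coeff_evalList l i
  rw [h3, coeff_zero, List.getD_eq_getElem _ _ hi] at h4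
  simp [← h4] at hc'

/-- The derivative of `P` times `(4 - X) (10 - X) ^ 3`, reduced modulo `P`. -/
def derivMultA : List ℤ :=
  mulMod tailA (derivList (tailA ++ [1])) (mulList [4, -1] ((mulList [10, -1])^[3] [1]))

theorem exists_ringOfIntegers_root {L : Type} [Field L] {t : List ℤ} {a : L}
    (ha : evalList a (t ++ [1]) = 0) :
    ∃ β : 𝓞 L, evalList β (t ++ [1]) = 0 := by
  have hint : IsIntegral ℤ a := ⟨_, monic_evalList_append_one t, by
    rw [← aeval_def, aeval_evalList, ha]⟩
  obtain ⟨β, hβ⟩ := IsIntegralClosure.isIntegral_iff (A := 𝓞 L) |>.mp hint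
  refine ⟨β, RingOfIntegers.coe_injective ?_⟩
  rw [map_evalList, hβ, map_zero, ha]

section discr

variable {L : Type} [Field L] [NumberField L] {α : 𝓞 L}

theorem exists_evalList_tailB_eq_zero (hα : evalList α (tailA ++ [1]) = 0) :
    ∃ β : 𝓞 L, evalList β (tailB ++ [1]) = 0 := by
  have ha : evalList (α : L) (tailA ++ [1]) = 0 := by
    have := map_evalList (algebraMap (𝓞 L) L) α (tailA ++ [1])
    rw [hα, map_zero] at this
    exact this.symm
  have hb : Represents (α : L) _ (bNum, bDen) := Represents.of_div _ bNum (d := bDen) (by decide)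
  have h0 := (hb.eval tailA_ne_nil ha (tailB ++ [1])).eq_zero (by decide +kernel)
    (by decide +kernel)
  exact exists_ringOfIntegers_root h0

theorem evalList_derivList_mem_differentIdeal {t : List ℤ}
    (hirr : Irreducible (evalList (X : ℤ[X]) (t ++ [1]))) (hα : evalList α (t ++ [1]) = 0)
    (hrank : Module.finrank ℚ L = t.length) :
    evalList α (derivList (t ++ [1])) ∈ differentIdeal ℤ (𝓞 L) := by
  obtain ⟨h1, h2⟩ := minpoly_eq_and_adjoin_eq_top hirr hα hrank
  have := aeval_derivative_mem_differentIdeal ℤ ℚ L α h2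
  rwa [h1, derivative_evalList, aeval_evalList] at this

theorem sq_mem_differentIdeal (hα : evalList α (tailA ++ [1]) = 0)
    (hrank : Module.finrank ℚ L = 24) :
    ((11 ^ 2 : ℕ) : 𝓞 L) ∈ differentIdeal ℤ (𝓞 L) := by
  obtain ⟨β, hβ⟩ := exists_evalList_tailB_eq_zero hα
  have hA := Ideal.mul_mem_right (evalList α invDerivA) _
    (evalList_derivList_mem_differentIdeal irreducible_tailA hα hrank)
  have hB := Ideal.mul_mem_right (evalList β invDerivB) _
    (evalList_derivList_mem_differentIdeal irreducible_tailB hβ hrank)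
  rw [← evalList_mulMod tailA_ne_nil hα] at hA
  rw [← evalList_mulMod (by decide) hβ] at hB
  have eA := evalList_eq_zero_of_all α (l := addList
    (mulMod tailA (derivList (tailA ++ [1])) invDerivA) [-(11 ^ 2 * tameA)]) (by decide +kernel)
  have eB := evalList_smul_div β tameA (l := addList
    (mulMod tailB (derivList (tailB ++ [1])) invDerivB) [-1]) (by decide +kernel)
  rw [evalList_addList] at eA eB
  generalize evalList α (mulMod tailA (derivList (tailA ++ [1])) invDerivA) = A at eA hA
  generalize evalList β (mulMod tailB (derivList (tailB ++ [1])) invDerivB) = B at eB hB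
  generalize evalList β (List.map _ _) = z at eB
  simp only [evalList] at eA eB
  have e : ((11 ^ 2 : ℕ) : 𝓞 L) = B * 11 ^ 2 - A * z := by
    push_cast at eA eB ⊢
    linear_combination z * eA - 11 ^ 2 * eB
  rw [e]
  exact Ideal.sub_mem _ (Ideal.mul_mem_right _ _ hB) (Ideal.mul_mem_right _ _ hA)

theorem exists_natAbs_discr_eq_pow (hα : evalList α (tailA ++ [1]) = 0)
    (hrank : Module.finrank ℚ L = 24) : ∃ i, (discr L).natAbs = 11 ^ i := by
  have h1 : Ideal.absNorm (differentIdeal ℤ (𝓞 L)) ∣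
      Ideal.absNorm (Ideal.span {((11 ^ 2 : ℕ) : 𝓞 L)}) :=
    Ideal.absNorm_dvd_absNorm_of_le
      ((Ideal.span_singleton_le_iff_mem _).mpr (sq_mem_differentIdeal hα hrank))
  rw [Ideal.absNorm_span_natCast, absNorm_differentIdeal L, ← pow_mul] at h1
  obtain ⟨i, -, hi⟩ := (Nat.dvd_prime_pow (by norm_num : Nat.Prime 11)).mp h1
  exact ⟨i, hi⟩

theorem twoRootsMod_tailA (hα : evalList α (tailA ++ [1]) = 0)
    (hrank : Module.finrank ℚ L = 24) : TwoRootsMod 11 α 22 2 4 10 := by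
  obtain ⟨h1, h2⟩ := minpoly_eq_and_adjoin_eq_top irreducible_tailA hα hrank
  refine ⟨h2, by rw [h1]; exact map_evalList_tailA, hrank, by norm_num, by norm_num,
    ⟨evalList 4 (tailA ++ [1]) / 11, ?_⟩, ⟨evalList 10 (tailA ++ [1]) / 11, ?_⟩⟩ <;>
  · rw [h1, eval_evalList]
    decide +kernel

theorem abs_discr_of_evalList_tailA (hα : evalList α (tailA ++ [1]) = 0)
    (hrank : Module.finrank ℚ L = 24) : |discr L| = 11 ^ 44 := by
  have : Fact (Nat.Prime 11) := ⟨by norm_num⟩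
  have h := twoRootsMod_tailA hα hrank
  obtain ⟨h1, -⟩ := minpoly_eq_and_adjoin_eq_top irreducible_tailA hα hrank
  obtain ⟨i, hi⟩ := exists_natAbs_discr_eq_pow hα hrank
  obtain ⟨c, hc, hcd⟩ := h.exists_norm_derivative_eq (by norm_num)
  obtain ⟨A, hA, hA'⟩ := h.norm_pow_mul_pow 1 3
  have hZ := h.not_dvd_norm_aeval (evalList X (derivMultA.map (· / 11 ^ 2)))
    (by rw [eval_evalList]; decide +kernel) (by rw [eval_evalList]; decide +kernel)
  have e := evalList_smul_div α (11 ^ 2) (l := derivMultA) (by decide +kernel)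
  rw [aeval_evalList] at hZ
  rw [h1, derivative_evalList, aeval_evalList, hi] at hcd
  generalize evalList α (derivMultA.map (· / 11 ^ 2)) = z at hZ e
  simp only [derivMultA, evalList_mulMod tailA_ne_nil hα, evalList_mulList,
    evalList_iterate_mulList] at e
  generalize evalList α (derivList (tailA ++ [1])) = D at hcd e
  have e2 : (((4 : ℤ) : 𝓞 L) - α) ^ 1 * (((10 : ℤ) : 𝓞 L) - α) ^ 3 * D =
      algebraMap ℤ _ (11 ^ 2) * z := by
    rw [algebraMap_int_eq, eq_intCast, ← e]
    simp only [evalList]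
    push_cast
    ring
  have e3 := congrArg (Algebra.norm ℤ) e2
  rw [map_mul, map_mul (Algebra.norm ℤ) (algebraMap ℤ _ _), hA, Algebra.norm_algebraMap,
    RingOfIntegers.rank, hrank] at e3
  have e4 := congrArg Int.natAbs e3
  simp only [Int.natAbs_mul, Int.natAbs_pow, hcd] at e4
  replace hA' : ¬ 11 ∣ A.natAbs := fun h => hA' (Int.natCast_dvd.mpr h)
  replace hZ : ¬ 11 ∣ (Algebra.norm ℤ z).natAbs := fun h => hZ (Int.natCast_dvd.mpr h)
  have hAc : ¬ 11 ∣ A.natAbs * c := fun h =>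
    ((Nat.Prime.dvd_mul Fact.out).mp h).elim hA' hc
  have e5 : 11 ^ (i + 4) * (A.natAbs * c) = 11 ^ 48 * (Algebra.norm ℤ z).natAbs := by
    rw [show 11 ^ 48 = ((11 : ℤ).natAbs ^ 2) ^ 24 by norm_num, ← e4, pow_add]
    norm_num
    ring
  have hi44 : i + 4 = 48 := by
    rcases lt_trichotomy (i + 4) 48 with hlt | heq | hgt
    · obtain ⟨k, hk⟩ := Nat.exists_eq_add_of_lt hlt
      rw [hk, add_assoc (i + 4), pow_add 11 (i + 4) (k + 1), mul_assoc] at e5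
      refine absurd ⟨11 ^ k * (Algebra.norm ℤ z).natAbs, ?_⟩ hAc
      rw [Nat.eq_of_mul_eq_mul_left (pow_pos (by norm_num) _) e5]
      ring
    · exact heq
    · obtain ⟨k, hk⟩ := Nat.exists_eq_add_of_lt hgt
      rw [hk, add_assoc 48, pow_add 11 48 (k + 1), mul_assoc] at e5
      refine absurd ⟨11 ^ k * (A.natAbs * c), ?_⟩ hZ
      rw [← Nat.eq_of_mul_eq_mul_left (pow_pos (by norm_num) _) e5]
      ring
  have : i = 44 := by omega
  rw [Int.abs_eq_natAbs, hi, this]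
  norm_num

end discr

theorem exists_numberField : ∃ (M : Type) (_ : Field M) (_ : NumberField M) (α : 𝓞 M),
    evalList α (tailA ++ [1]) = 0 ∧ Module.finrank ℚ M = 24 := by
  set P := (evalList (X : ℤ[X]) (tailA ++ [1])).map (algebraMap ℤ ℚ) with hP
  have hm := monic_evalList_append_one tailA
  have : Fact (Irreducible P) :=
    ⟨(hm.irreducible_iff_irreducible_map_fraction_map (K := ℚ)).mp irreducible_tailA⟩
  have hPm : P.Monic := hm.map _
  have hd : P.natDegree = 24 := by rw [hP, hm.natDegree_map, natDegree_evalList_append_one]; rfl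
  have hr : Module.finrank ℚ (AdjoinRoot P) = 24 := by
    rw [(AdjoinRoot.powerBasis hPm.ne_zero).finrank, AdjoinRoot.powerBasis_dim, hd]
  have : FiniteDimensional ℚ (AdjoinRoot P) := Module.finite_of_finrank_pos (by rw [hr]; norm_num)
  have : CharZero (AdjoinRoot P) := charZero_of_injective_algebraMap (algebraMap ℚ _).injective
  have h0 : evalList (AdjoinRoot.root P) (tailA ++ [1]) = 0 := by
    have h1 := map_evalList (mapRingHom (algebraMap ℤ ℚ)) X (tailA ++ [1])
    have h2 := map_evalList (AdjoinRoot.mk P) X (tailA ++ [1])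
    rw [coe_mapRingHom, ← hP, map_X] at h1
    rw [← h1, AdjoinRoot.mk_self, AdjoinRoot.mk_X] at h2
    exact h2.symm
  have hn : NumberField (AdjoinRoot P) := ⟨⟩
  obtain ⟨α, hα⟩ := exists_ringOfIntegers_root h0
  exact ⟨AdjoinRoot P, inferInstance, hn, α, hα, hr⟩

theorem evalList_mem {M : Type} [Field M] [CharZero M] (F : IntermediateField ℚ M) {x : M}
    (hx : x ∈ F) (l : List ℤ) : evalList x l ∈ F := by
  induction l with
  | nil => exact F.zero_mem
  | cons c l ih => exact F.add_mem (intCast_mem F c) (F.mul_mem hx ih)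

/-- The polynomial `f_D · f̄_D`. -/
noncomputable def fNorm : ℚ[X] :=
  fRat (C (4 * 2087 ^ 3 / 99)) X ^ 2 + 11 * fIrr (C (4 * 2087 ^ 3 / 99)) X ^ 2

theorem natDegree_fNorm : fNorm.natDegree = 24 := natDegree_fRat_sq_add_fIrr_sq _

theorem aeval_fNorm {M : Type} [Field M] [CharZero M] (x : M) :
    aeval x fNorm = fRat (4 * 2087 ^ 3 / 99) x ^ 2 + 11 * fIrr (4 * 2087 ^ 3 / 99) x ^ 2 := by
  have h1 := map_fRat (aeval x : ℚ[X] →ₐ[ℚ] M).toRingHom (C (4 * 2087 ^ 3 / 99)) X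
  have h2 := map_fIrr (aeval x : ℚ[X] →ₐ[ℚ] M).toRingHom (C (4 * 2087 ^ 3 / 99)) X
  simp only [AlgHom.toRingHom_eq_coe, RingHom.coe_coe, aeval_C, aeval_X] at h1 h2
  simp only [fNorm, map_add, map_mul, map_pow, map_ofNat, h1, h2, map_div₀]

/-- A number field of discriminant `± 11 ^ 44` generated by a root of `f_D · f̄_D`. -/
theorem exists_primitive_root_fNorm : ∃ (M : Type) (_ : Field M) (_ : NumberField M) (x : M),
    aeval x fNorm = 0 ∧ IntermediateField.adjoin ℚ {x} = ⊤ ∧ Module.finrank ℚ M = 24 ∧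
      |discr M| = 11 ^ 44 := by
  obtain ⟨M, _, _, α, hα, hr⟩ := exists_numberField
  refine ⟨M, inferInstance, inferInstance, ?_⟩
  have ha : evalList (α : M) (tailA ++ [1]) = 0 := by
    have := map_evalList (algebraMap (𝓞 M) M) α (tailA ++ [1])
    rw [hα, map_zero] at this
    exact this.symm
  obtain ⟨x, u, hu, hx, ⟨l, hl, hl', hne⟩, hαx⟩ := exists_root ha
  have hne := hne (evalList_ne_zero_of_irreducible irreducible_tailA ha hl hl')
  refine ⟨x, ?_, ?_, hr, abs_discr_of_evalList_tailA hα hr⟩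
  · rw [aeval_fNorm, ← fVal_mul_fVal_neg hu, hx, zero_mul]
  have hc : (4 * 2087 ^ 3 / 99 : M) ∈ IntermediateField.adjoin ℚ {x} := by
    have := (IntermediateField.adjoin ℚ {x}).algebraMap_mem (4 * 2087 ^ 3 / 99)
    simpa using this
  set F := IntermediateField.adjoin ℚ {x} with hF
  have hxF : x ∈ F := IntermediateField.mem_adjoin_simple_self ℚ x
  rw [fVal_eq hu] at hx
  rw [fVal_eq (u := -u) (by rw [neg_sq, hu])] at hne
  have hI : fIrr (4 * 2087 ^ 3 / 99) x ≠ 0 := by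
    intro h0
    rw [h0] at hx hne
    exact hne (by linear_combination hx)
  have hu' : u = - fRat (4 * 2087 ^ 3 / 99) x / fIrr (4 * 2087 ^ 3 / 99) x := by
    rw [eq_div_iff hI]
    linear_combination hx
  have huF : u ∈ F := by
    have h1 := map_fRat (algebraMap F M) ⟨_, hc⟩ ⟨x, hxF⟩
    have h2 := map_fIrr (algebraMap F M) ⟨_, hc⟩ ⟨x, hxF⟩
    simp only [IntermediateField.algebraMap_apply] at h1 h2
    rw [hu', ← h1, ← h2]
    exact F.div_mem (F.neg_mem (SetLike.coe_mem _)) (SetLike.coe_mem _)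
  have haF : (α : M) ∈ F := by
    have h0 : (alphaDen : M) ≠ 0 := by exact_mod_cast (by decide : alphaDen ≠ 0)
    rw [mul_comm, ← eq_div_iff h0] at hαx
    rw [hαx]
    exact F.div_mem (F.add_mem (evalList_mem F hxF _) (F.mul_mem (F.div_mem
      (F.add_mem F.one_mem huF) (ofNat_mem F 2)) (evalList_mem F hxF _))) (intCast_mem F _)
  obtain ⟨-, h2⟩ := minpoly_eq_and_adjoin_eq_top irreducible_tailA hα hr
  rw [eq_top_iff, ← IntermediateField.toSubalgebra_le_toSubalgebra,
    IntermediateField.top_toSubalgebra, ← h2]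
  exact Algebra.adjoin_le (Set.singleton_subset_iff.mpr haF)

theorem irreducible_fNorm : Irreducible fNorm := by
  obtain ⟨M, _, _, x, hx, hgen, hr, -⟩ := exists_primitive_root_fNorm
  have hdeg := (Field.primitive_element_iff_minpoly_natDegree_eq ℚ x).mp hgen
  have hint : IsIntegral ℚ x := Algebra.IsIntegral.isIntegral x
  have h0 : fNorm ≠ 0 := fun h => by simpa [h] using natDegree_fNorm
  exact (associated_of_dvd_of_natDegree_le (minpoly.dvd ℚ x hx) h0
    (by rw [natDegree_fNorm, hdeg, hr])).irreducible (minpoly.irreducible hint)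

theorem minpoly_eq_of_irreducible {f : ℚ[X]} (hf : Irreducible f) {M : Type} [Field M]
    [NumberField M] {x : M} (hx : aeval x f = 0) : minpoly ℚ x = f * C f.leadingCoeff⁻¹ :=
  (minpoly.eq_of_irreducible hf hx).symm

theorem algebraAdjoin_eq_top {M : Type} [Field M] [NumberField M] {x : M}
    (h : IntermediateField.adjoin ℚ {x} = ⊤) : Algebra.adjoin ℚ {x} = ⊤ := by
  rw [← IntermediateField.adjoin_simple_toSubalgebra_of_isAlgebraic
    (Algebra.IsAlgebraic.isAlgebraic (R := ℚ) x), h, IntermediateField.top_toSubalgebra]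

theorem abs_discr_of_root_fNorm {L : Type} [Field L] [NumberField L] {y : L}
    (hy : aeval y fNorm = 0) (hgen : IntermediateField.adjoin ℚ {y} = ⊤) :
    |discr L| = 11 ^ 44 := by
  obtain ⟨M, _, _, x, hx, hgen', -, hd⟩ := exists_primitive_root_fNorm
  let Bx := PowerBasis.ofAdjoinEqTop (Algebra.IsIntegral.isIntegral x) (algebraAdjoin_eq_top hgen')
  let By := PowerBasis.ofAdjoinEqTop (Algebra.IsIntegral.isIntegral y) (algebraAdjoin_eq_top hgen)
  have e : minpoly ℚ Bx.gen = minpoly ℚ By.gen := by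
    simp only [Bx, By, PowerBasis.ofAdjoinEqTop_gen]
    rw [minpoly_eq_of_irreducible irreducible_fNorm hx,
      minpoly_eq_of_irreducible irreducible_fNorm hy]
  rw [← hd, discr_eq_discr_of_algEquiv L (Bx.equivOfMinpoly By e).symm]

/-- Let `u = √-11` and `τ = 2087³/(2⁶·3¹⁵·11)`.  The product
`h = f_D(τ,x)·f̄_D(τ,x)` (where `f̄_D` is obtained by replacing `u` by `-u`) has rational
coefficients, is irreducible of degree `24` over `ℚ`, and the number field `ℚ[x]/(h)` has
discriminant of absolute value `11⁴⁴`. -/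
theorem fD2_specialized_discr_11_pow_44 (K : Type) [Field K] [Algebra ℚ K]
    (u : K) (hu : u ^ 2 = -11) (hgen : IntermediateField.adjoin ℚ {u} = ⊤) :
    let τ : ℚ := 2087 ^ 3 / (2 ^ 6 * 3 ^ 15 * 11)
    -- `fD v` is `f_D(τ,x)` with `v` in place of `u`; the conjugate `f̄_D(τ,x)` is `fD (-u)`
    let fD : K → Polynomial K := fun v =>
      -11 ^ 2 * C v * (1188 * C v * X ^ 3 + 198 * C v * X ^ 2 - 1346 * C v * X - 27 * C v
          + 594 * X ^ 4 - 7920 * X ^ 2 - 1474 * X + 135) ^ 3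
        - 2 ^ 8 * 3 ^ 13 * (253 * C v - 67) * C (algebraMap ℚ K τ) * X
    ∀ h : Polynomial ℚ, h.map (algebraMap ℚ K) = fD u * fD (-u) →
      Irreducible h ∧ h.natDegree = 24 ∧
        ∀ (L : Type) [Field L] [NumberField L] (x : L),
          Polynomial.aeval x h = 0 → IntermediateField.adjoin ℚ {x} = ⊤ →
          |NumberField.discr L| = 11 ^ 44 := by
  intro τ fD h hh
  have hc : (2 ^ 8 * 3 ^ 13 * C (algebraMap ℚ K τ) : K[X]) =
      C (algebraMap ℚ K (4 * 2087 ^ 3 / 99)) := by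
    have : (4 * 2087 ^ 3 / 99 : ℚ) = 2 ^ 8 * 3 ^ 13 * τ := by simp only [τ]; norm_num
    rw [this]
    simp only [map_mul, map_pow, map_ofNat]
  have hf : ∀ v, fD v = fVal (C (algebraMap ℚ K (4 * 2087 ^ 3 / 99))) (C v) X := by
    intro v
    simp only [fD, fVal, ← hc]
    ring
  have hCu : (C u : K[X]) ^ 2 = -11 := by
    rw [← C_pow, hu, map_neg, map_ofNat]
  have hN : h = fNorm := by
    apply map_injective (algebraMap ℚ K) (algebraMap ℚ K).injective
    rw [hh, hf, hf, C_neg, fVal_mul_fVal_neg hCu, ← coe_mapRingHom, fNorm, map_add, map_mul,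
      map_pow, map_pow, map_fRat, map_fIrr, map_ofNat, coe_mapRingHom, map_C, map_X]
  subst hN
  exact ⟨irreducible_fNorm, natDegree_fNorm, fun L _ _ x hx hx' => abs_discr_of_root_fNorm hx hx'⟩
end
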